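/- There exists a constant C > 0, depending only on β and N, such that for every n ≥ 1 and every differentiable function h : ℝ → ℝ with sup_x |h′(x)| ≤ 1, one has |E_{P_{n,β}}[h(W_n/B)] − E[h(Z)]| ≤ C n^{−1/2}, where Z is a standard normal random variable. (Wasserstein bound of the main theorem.) -/

import Mathlib

open MeasureTheory Real RealInnerProductSpace

noncomputable section

def besselRatio (N : ℕ) (x : ℝ) : ℝ :=
  x / ((N : ℝ) - 1) *
      (∫ θ in (0:ℝ)..π, Real.exp (x * Real.cos θ) * Real.sin θ ^ N) /
    ∫ θ in (0:ℝ)..π, Real.exp (x * Real.cos θ) * Real.sin θ ^ (N - 2)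

/-- The unit sphere `S^{N-1}` in `ℝ^N`. -/
abbrev UnitSphere (N : ℕ) := Metric.sphere (0 : EuclideanSpace ℝ (Fin N)) 1

/-- The map on the unit sphere induced by a linear isometry of `ℝ^N`. -/
def sphereMap {N : ℕ}
    (e : EuclideanSpace ℝ (Fin N) ≃ₗᵢ[ℝ] EuclideanSpace ℝ (Fin N))
    (θ : UnitSphere N) : UnitSphere N :=
  ⟨e θ, by
    rw [mem_sphere_zero_iff_norm, e.norm_map]
    exact mem_sphere_zero_iff_norm.mp θ.2⟩

/-- Total spin `S_n(σ) = ∑ i, σ_i`. -/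
def totalSpin {N n : ℕ} (σ : Fin n → UnitSphere N) : EuclideanSpace ℝ (Fin N) :=
  ∑ i, (σ i : EuclideanSpace ℝ (Fin N))

/-- `W_n(σ) = √n (β²/(n²b²) |S_n(σ)|² - 1)`. -/
def Wspin (N n : ℕ) (β b : ℝ) (σ : Fin n → UnitSphere N) : ℝ :=
  Real.sqrt n * (β ^ 2 / ((n : ℝ) ^ 2 * b ^ 2) * ‖totalSpin σ‖ ^ 2 - 1)

/-- The (unnormalized) Gibbs weight `exp((β/(2n)) ∑_i ∑_j ⟨σ_i, σ_j⟩)`. -/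
def gibbsWeight (N n : ℕ) (β : ℝ) (σ : Fin n → UnitSphere N) : ℝ :=
  Real.exp (β / (2 * n) * ∑ i, ∑ j,
    ⟪(σ i : EuclideanSpace ℝ (Fin N)), (σ j : EuclideanSpace ℝ (Fin N))⟫)

/-- The Gibbs measure `P_{n,β}` on `(S^{N-1})^n`. -/
def gibbsMeasure (N n : ℕ) (β : ℝ) (μ : Measure (UnitSphere N))
    [IsProbabilityMeasure μ] : Measure (Fin n → UnitSphere N) :=
  (Measure.pi fun _ : Fin n => μ).withDensity fun σ =>
    ENNReal.ofReal
      (gibbsWeight N n β σ / ∫ τ, gibbsWeight N n β τ ∂(Measure.pi fun _ : Fin n => μ))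

end

noncomputable section PartA

lemma aux_hasDerivAt_expint {α : Type*} [MeasurableSpace α] (ν : Measure α) [IsFiniteMeasure ν]
    (X m : α → ℝ) (hX : Measurable X) (hm : Measurable m) (c : ℝ)
    (hXb : ∀ᵐ a ∂ν, |X a| ≤ 1) (hmb : ∀ᵐ a ∂ν, |m a| ≤ c) (t : ℝ) :
    HasDerivAt (fun t => ∫ a, m a * exp (t * X a) ∂ν)
      (∫ a, m a * X a * exp (t * X a) ∂ν) t := by
  have hme : ∀ t : ℝ, Measurable fun a => m a * exp (t * X a) := fun t => by fun_prop
  have hb : ∀ t : ℝ, ∀ᵐ a ∂ν, exp (t * X a) ≤ exp |t| := fun t => by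
    filter_upwards [hXb] with a ha
    apply Real.exp_le_exp.2
    calc t * X a ≤ |t * X a| := le_abs_self _
      _ = |t| * |X a| := abs_mul _ _
      _ ≤ |t| * 1 := by gcongr
      _ = |t| := mul_one _
  have := hasDerivAt_integral_of_dominated_loc_of_deriv_le (μ := ν)
    (F := fun t a => m a * exp (t * X a)) (F' := fun t a => m a * X a * exp (t * X a))
    (x₀ := t) (s := Metric.ball t 1) (bound := fun _ => |c| * exp (|t| + 1)) (Metric.ball_mem_nhds _ one_pos)
    (Filter.Eventually.of_forall fun t => (hme t).aestronglyMeasurable) ?_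
    (by fun_prop : Measurable fun a => m a * X a * exp (t * X a)).aestronglyMeasurable ?_ ?_ ?_
  · exact this.2
  · refine Integrable.of_bound (hme t).aestronglyMeasurable (|c| * exp |t|) ?_
    filter_upwards [hb t, hmb] with a h1 h2
    rw [norm_mul, Real.norm_eq_abs, Real.norm_eq_abs, abs_of_pos (exp_pos _)]
    exact mul_le_mul (h2.trans (le_abs_self _)) h1 (exp_pos _).le (abs_nonneg _)
  · filter_upwards [hXb, hmb] with a h1 h2 x hx
    rw [norm_mul, norm_mul, Real.norm_eq_abs, Real.norm_eq_abs, Real.norm_eq_abs, abs_of_pos (exp_pos _)]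
    have hx' : |x| ≤ |t| + 1 := by
      have := Metric.mem_ball.1 hx
      rw [Real.dist_eq] at this
      calc |x| = |t + (x - t)| := by ring_nf
        _ ≤ |t| + |x - t| := abs_add_le _ _
        _ ≤ _ := by linarith
    have h3 : x * X a ≤ |t| + 1 := by
      calc x * X a ≤ |x * X a| := le_abs_self _
        _ = |x| * |X a| := abs_mul _ _
        _ ≤ (|t| + 1) * 1 := by gcongr
        _ = _ := mul_one _
    have h4 : |m a| ≤ |c| := h2.trans (le_abs_self _)
    calc |m a| * |X a| * exp (x * X a) ≤ |c| * 1 * exp (|t| + 1) := by gcongr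
      _ = _ := by ring
  · exact integrable_const _
  · refine Filter.Eventually.of_forall fun a x _ => ?_
    have : HasDerivAt (fun x => m a * exp (x * X a)) (m a * (exp (x * X a) * (1 * X a))) x :=
      (((hasDerivAt_id x).mul_const (X a)).exp).const_mul _
    refine this.congr_deriv ?_
    ring

/-- sine-exponential integral -/
def sI (k : ℕ) (x : ℝ) : ℝ := ∫ θ in (0:ℝ)..π, Real.exp (x * Real.cos θ) * Real.sin θ ^ k

lemma sI_pos (k : ℕ) (x : ℝ) : 0 < sI k x := by
  apply intervalIntegral.intervalIntegral_pos_of_pos_on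
  · apply Continuous.intervalIntegrable; fun_prop
  · intro θ hθ
    have := Real.sin_pos_of_pos_of_lt_pi hθ.1 hθ.2
    positivity
  · exact Real.pi_pos

lemma sI_hasDerivAt' (k : ℕ) (x : ℝ) :
    HasDerivAt (sI k) (∫ θ in (0:ℝ)..π, Real.cos θ * Real.exp (x * Real.cos θ) * Real.sin θ ^ k) x := by
  have := aux_hasDerivAt_expint (volume.restrict (Set.Ioc 0 π)) Real.cos (fun θ => Real.sin θ ^ k)
    (by fun_prop) (by fun_prop) 1 (Filter.Eventually.of_forall fun a => Real.abs_cos_le_one a)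
    (Filter.Eventually.of_forall fun a => by
      rw [abs_pow]; exact pow_le_one₀ (abs_nonneg _) (Real.abs_sin_le_one a)) x
  convert this using 1
  · ext t
    rw [sI, intervalIntegral.integral_of_le Real.pi_pos.le]
    simp only [mul_comm]
  · rw [intervalIntegral.integral_of_le Real.pi_pos.le]
    congr 1; ext θ; ring

lemma sI_ibp (N : ℕ) (hN : 2 ≤ N) (x : ℝ) :
    (∫ θ in (0:ℝ)..π, Real.cos θ * Real.exp (x * Real.cos θ) * Real.sin θ ^ (N - 2))
      = x / ((N:ℝ) - 1) * sI N x := by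
  obtain ⟨k, rfl⟩ := Nat.exists_eq_add_of_le hN
  have hd : ∀ θ ∈ Set.uIcc (0:ℝ) π, HasDerivAt (fun θ => Real.exp (x * Real.cos θ) * Real.sin θ ^ (k+1))
      ((k+1) * (Real.cos θ * Real.exp (x * Real.cos θ) * Real.sin θ ^ k) -
        x * (Real.exp (x * Real.cos θ) * Real.sin θ ^ (2+k))) θ := by
    intro θ _
    have h1 := ((Real.hasDerivAt_cos θ).const_mul x).exp.mul ((Real.hasDerivAt_sin θ).pow (k+1))
    refine h1.congr_deriv ?_
    push_cast
    simp only [Pi.pow_apply]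
    ring
  have h := intervalIntegral.integral_eq_sub_of_hasDerivAt hd (by
    apply Continuous.intervalIntegrable; fun_prop)
  rw [intervalIntegral.integral_sub (by apply Continuous.intervalIntegrable; fun_prop)
    (by apply Continuous.intervalIntegrable; fun_prop), intervalIntegral.integral_const_mul,
    intervalIntegral.integral_const_mul] at h
  simp only [Real.sin_pi, Real.sin_zero, ne_eq, Nat.add_eq_zero_iff, one_ne_zero, and_false,
    not_false_eq_true, zero_pow, mul_zero, sub_zero] at h
  have hk : (0:ℝ) < k + 1 := by positivity
  have e : 2 + k - 2 = k := by omega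
  rw [e, sI]
  push_cast
  have : (2 + (k:ℝ) - 1) = k + 1 := by ring
  rw [this]
  rw [div_mul_eq_mul_div, eq_div_iff hk.ne']
  linarith

lemma sI_le (N : ℕ) (hN : 2 ≤ N) (x : ℝ) : sI N x ≤ sI (N-2) x := by
  apply intervalIntegral.integral_mono_on Real.pi_pos.le
  · apply Continuous.intervalIntegrable; fun_prop
  · apply Continuous.intervalIntegrable; fun_prop
  · intro θ hθ
    have h0 := Real.sin_nonneg_of_mem_Icc hθ
    have : Real.sin θ ^ N ≤ Real.sin θ ^ (N-2) :=
      pow_le_pow_of_le_one h0 (Real.sin_le_one _) (by omega)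
    gcongr

lemma sI_hasDerivAt (N : ℕ) (hN : 2 ≤ N) (x : ℝ) :
    HasDerivAt (sI (N-2)) (x / ((N:ℝ) - 1) * sI N x) x := by
  rw [← sI_ibp N hN]; exact sI_hasDerivAt' _ _

lemma sI_hasDerivAt2 (N : ℕ) (hN : 2 ≤ N) (x : ℝ) :
    HasDerivAt (fun x => x / ((N:ℝ) - 1) * sI N x) (sI (N-2) x - sI N x) x := by
  have := aux_hasDerivAt_expint (volume.restrict (Set.Ioc 0 π)) Real.cos
    (fun θ => Real.cos θ * Real.sin θ ^ (N-2))
    (by fun_prop) (by fun_prop) 1 (Filter.Eventually.of_forall fun a => Real.abs_cos_le_one a)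
    (Filter.Eventually.of_forall fun a => by
      rw [abs_mul, abs_pow]
      exact mul_le_one₀ (Real.abs_cos_le_one a) (by positivity) (pow_le_one₀ (abs_nonneg _) (Real.abs_sin_le_one a))) x
  convert this using 1
  · ext t
    rw [← sI_ibp N hN, intervalIntegral.integral_of_le Real.pi_pos.le]
    congr 1; ext θ; ring
  · rw [sI, sI, ← intervalIntegral.integral_sub (by apply Continuous.intervalIntegrable; fun_prop)
      (by apply Continuous.intervalIntegrable; fun_prop), intervalIntegral.integral_of_le Real.pi_pos.le]
    congr 1; ext θ
    obtain ⟨k, rfl⟩ := Nat.exists_eq_add_of_le hN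
    have e : 2 + k - 2 = k := by omega
    rw [e, pow_add, Real.sin_sq]
    ring

/-- `K(r) = f(r)/r`. -/
def Kf (N : ℕ) (x : ℝ) : ℝ := sI N x / (((N:ℝ) - 1) * sI (N-2) x)

lemma Nm1_pos (N : ℕ) (hN : 2 ≤ N) : (1:ℝ) ≤ (N:ℝ) - 1 := by
  have : (2:ℝ) ≤ N := by exact_mod_cast hN
  linarith

lemma besselRatio_eq (N : ℕ) (x : ℝ) : besselRatio N x = x * Kf N x := by
  unfold besselRatio Kf sI
  rw [mul_div_assoc, div_mul_eq_mul_div, mul_div_assoc, div_div, mul_comm (∫ _ in (0:ℝ)..π, _ * Real.sin _ ^ (N-2))]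

lemma Kf_pos (N : ℕ) (hN : 2 ≤ N) (x : ℝ) : 0 < Kf N x := by
  have := Nm1_pos N hN
  have := sI_pos N x
  have := sI_pos (N-2) x
  unfold Kf; positivity

lemma Kf_le (N : ℕ) (hN : 2 ≤ N) (x : ℝ) : ((N:ℝ) - 1) * Kf N x ≤ 1 := by
  have h1 := Nm1_pos N hN
  have h2 := sI_pos N x
  have h3 := sI_pos (N-2) x
  unfold Kf
  rw [← mul_div_assoc, mul_div_mul_left _ _ (by linarith), div_le_one h3]
  exact sI_le N hN x

lemma Kf_le_one (N : ℕ) (hN : 2 ≤ N) (x : ℝ) : Kf N x ≤ 1 := by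
  nlinarith [Kf_le N hN x, Kf_pos N hN x, Nm1_pos N hN]

lemma sI_J1 (N : ℕ) (hN : 2 ≤ N) (x : ℝ) : x / ((N:ℝ) - 1) * sI N x = x * Kf N x * sI (N-2) x := by
  have h1 := Nm1_pos N hN
  have h3 := sI_pos (N-2) x
  unfold Kf
  field_simp

lemma sI_A (N : ℕ) (hN : 2 ≤ N) (x : ℝ) : sI N x = ((N:ℝ) - 1) * Kf N x * sI (N-2) x := by
  have h1 := Nm1_pos N hN
  have h3 := sI_pos (N-2) x
  unfold Kf
  field_simp

lemma mul_Kf_le_one (N : ℕ) (hN : 2 ≤ N) (x : ℝ) : x * Kf N x ≤ 1 := by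
  have h3 := sI_pos (N-2) x
  have : x * Kf N x * sI (N-2) x ≤ sI (N-2) x := by
    rw [← sI_J1 N hN, ← sI_ibp N hN]
    apply intervalIntegral.integral_mono_on Real.pi_pos.le
    · apply Continuous.intervalIntegrable; fun_prop
    · apply Continuous.intervalIntegrable; fun_prop
    · intro θ hθ
      have h0 := Real.sin_nonneg_of_mem_Icc hθ
      have := Real.cos_le_one θ
      gcongr
      nlinarith [exp_pos (x * Real.cos θ)]
  nlinarith

lemma Kf_continuous (N : ℕ) (hN : 2 ≤ N) : Continuous (Kf N) := by
  have h1 := Nm1_pos N hN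
  unfold Kf
  refine Continuous.div ?_ ?_ ?_
  · exact continuous_iff_continuousAt.2 fun x => (sI_hasDerivAt' N x).continuousAt
  · exact continuous_const.mul (continuous_iff_continuousAt.2 fun x => (sI_hasDerivAt' _ x).continuousAt)
  · intro x
    have := sI_pos (N-2) x
    positivity

lemma Kf_hasDerivAt (N : ℕ) (hN : 2 ≤ N) (r : ℝ) (hr : 0 < r) :
    HasDerivAt (Kf N) ((1 - N * Kf N r - r^2 * Kf N r ^ 2) / r) r := by
  have h3 := sI_pos (N-2) r
  have hne : r * sI (N-2) r ≠ 0 := by positivity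
  have hd := (sI_hasDerivAt2 N hN r).div ((hasDerivAt_id r).mul (sI_hasDerivAt N hN r)) hne
  have := hd.congr_of_eventuallyEq (f₁ := Kf N) (by
    filter_upwards [lt_mem_nhds hr] with x hx
    have h3 := sI_pos (N-2) x
    simp only [Pi.div_apply, Pi.mul_apply, id]
    rw [sI_J1 N hN]
    field_simp)
  refine this.congr_deriv ?_
  simp only [Pi.mul_apply, id]
  rw [sI_J1 N hN, sI_A N hN]
  field_simp
  ring

lemma Kf_neg (N : ℕ) (hN : 2 ≤ N) (r : ℝ) (hr : 0 < r) :
    1 - N * Kf N r - r^2 * Kf N r ^ 2 < 0 := by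
  obtain ⟨k, rfl⟩ := Nat.exists_eq_add_of_le hN
  set J := sI (2 + k - 2) with hJ
  set J1 := fun x => x / (((2+k:ℕ):ℝ) - 1) * sI (2+k) x with hJ1
  have hdJ : ∀ x, HasDerivAt J (J1 x) x := fun x => sI_hasDerivAt _ hN x
  have hdJ1 : ∀ x, HasDerivAt J1 (J x - sI (2+k) x) x := fun x => sI_hasDerivAt2 _ hN x
  have hA : ∀ x, x * sI (2+k) x = (k+1) * J1 x := by
    intro x
    have : ((2+k:ℕ):ℝ) - 1 = k + 1 := by push_cast; ring
    simp only [hJ1, this]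
    have : (k:ℝ) + 1 ≠ 0 := by positivity
    field_simp
  let T : ℝ → ℝ := fun x => x^(k+2) * J x^2 - (k+2) * (x^(k+1) * (J x * J1 x)) - x^(k+2) * J1 x ^2
  have hT : ∀ x, HasDerivAt T (-2 * x^(k+1) * J1 x^2) x := by
    intro x
    have h1 := (((hasDerivAt_pow (k+2) x).mul ((hdJ x).pow 2)).sub
      (((hasDerivAt_pow (k+1) x).mul ((hdJ x).mul (hdJ1 x))).const_mul ((k:ℝ)+2))).sub
      ((hasDerivAt_pow (k+2) x).mul ((hdJ1 x).pow 2))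
    refine h1.congr_deriv ?_
    clear_value J1; simp only [Pi.pow_apply, Pi.mul_apply, Nat.add_sub_cancel, show k + 2 - 1 = k + 1 by omega]
    push_cast
    have h := hA x
    have e1 : x^(k+1) * sI (2+k) x = (k+1) * x^k * J1 x := by rw [pow_succ, mul_assoc, h]; ring
    have e2 : x^(k+2) * sI (2+k) x = (k+1) * x^(k+1) * J1 x := by rw [pow_succ, mul_assoc, h]; ring
    linear_combination (k+2:ℝ) * J x * e1 + 2 * J1 x * e2
  have hpos : ∀ x, 0 < x → 0 < J1 x := by
    intro x hx
    have := sI_pos (2+k) x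
    have := Nm1_pos _ hN
    simp only [hJ1]; positivity
  have hanti : StrictAntiOn T (Set.Ici 0) := by
    apply strictAntiOn_of_deriv_neg (convex_Ici 0)
    · exact fun x _ => (hT x).continuousAt.continuousWithinAt
    · intro x hx
      rw [interior_Ici] at hx
      rw [(hT x).deriv]
      have := hpos x hx
      have hx' : 0 < x := hx
      have : 0 < x^(k+1) * J1 x^2 := by positivity
      linarith
  have h0 := hanti (Set.mem_Ici.2 le_rfl) (Set.mem_Ici.2 hr.le) hr
  have hT0 : T 0 = 0 := by simp [T]
  rw [hT0] at h0
  have hJr : 0 < J r := sI_pos _ _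
  have e : T r = r^(k+2) * J r^2 * (1 - ((2+k:ℕ):ℝ) * Kf (2+k) r - r^2 * Kf (2+k) r^2) := by
    have : J1 r = r * Kf (2+k) r * J r := sI_J1 _ hN r
    simp only [T, this]
    push_cast
    ring
  rw [e] at h0
  have : 0 < r^(k+2) * J r^2 := by positivity
  by_contra hcon
  push Not at hcon
  nlinarith [mul_nonneg this.le hcon]

end PartA

noncomputable section PartB

def Vf (N : ℕ) (r : ℝ) : ℝ := 1 - ((N:ℝ) - 1) * Kf N r - r^2 * Kf N r ^ 2

lemma Vf_abs_le (N : ℕ) (hN : 2 ≤ N) (r : ℝ) (hr : 0 ≤ r) : |Vf N r| ≤ 1 := by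
  have h1 := Kf_le N hN r
  have h2 := mul_Kf_le_one N hN r
  have h3 := Kf_pos N hN r
  have h4 := Nm1_pos N hN
  have h5 : 0 ≤ r * Kf N r := by positivity
  have h6 : 0 ≤ ((N:ℝ) - 1) * Kf N r := by positivity
  unfold Vf
  rw [abs_le]
  constructor <;> nlinarith

lemma far_bound (b δ : ℝ) (hb : 0 < b) (hδ : 0 < δ) :
    ∃ C > 0, ∀ r, 0 ≤ r → δ ≤ |r - b| → 1 + r^2 ≤ C * |r^2 - b^2| := by
  refine ⟨1 + (1 + b^2) / (δ * b), by positivity, fun r hr h => ?_⟩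
  have e : |r^2 - b^2| = |r - b| * (r + b) := by
    rw [show r^2 - b^2 = (r-b)*(r+b) by ring, abs_mul, abs_of_nonneg (by linarith : 0 ≤ r + b)]
  have h1 : δ * b ≤ |r^2-b^2| := by
    rw [e]; apply mul_le_mul h (by linarith) hb.le (abs_nonneg _)
  have h2 : r^2 - b^2 ≤ |r^2-b^2| := le_abs_self _
  have h3 : 1 + b^2 ≤ (1 + b^2) / (δ * b) * |r^2 - b^2| := by
    rw [div_mul_eq_mul_div, le_div_iff₀ (by positivity)]
    gcongr
  nlinarith

lemma far_bound2 (b δ : ℝ) (hb : 0 < b) (hδ : 0 < δ) :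
    ∃ C > 0, ∀ r, 0 ≤ r → δ ≤ |r - b| → 1 + r^2 ≤ C * (r^2 - b^2)^2 := by
  obtain ⟨C, hC, h⟩ := far_bound b δ hb hδ
  refine ⟨C * C, by positivity, fun r hr hd => ?_⟩
  have h1 := h r hr hd
  have h2 : 1 ≤ C * |r^2 - b^2| := by nlinarith [sq_nonneg r]
  calc 1 + r^2 ≤ C * |r^2-b^2| := h1
    _ ≤ C * |r^2-b^2| * (C * |r^2 - b^2|) := le_mul_of_one_le_right (by positivity) h2
    _ = C * C * |r^2-b^2|^2 := by ring
    _ = _ := by rw [sq_abs]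

lemma near_bound (b r : ℝ) (hb : 0 < b) (hr : 0 ≤ r) : b * |r - b| ≤ |r^2 - b^2| := by
  rw [show r^2 - b^2 = (r+b)*(r-b) by ring, abs_mul, abs_of_nonneg (by linarith : 0 ≤ r + b)]
  gcongr; linarith

lemma lin_global (φ : ℝ → ℝ) (b d M : ℝ) (hb : 0 < b) (h0 : φ b = 0) (hd : HasDerivAt φ d b)
    (hM : ∀ r, 0 ≤ r → |φ r| ≤ M * (1 + r^2)) (hM0 : 0 ≤ M) :
    ∃ C > 0, ∀ r, 0 ≤ r → |φ r| ≤ C * |r^2 - b^2| := by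
  have h1 := hd.isBigO_sub.bound
  obtain ⟨c, hc⟩ := h1
  obtain ⟨δ, hδ, hball⟩ := Metric.eventually_nhds_iff.1 hc
  obtain ⟨C, hC, hfar⟩ := far_bound b δ hb hδ
  refine ⟨|c| / b + M * C + 1, by positivity, fun r hr => ?_⟩
  have hx := abs_nonneg (r^2-b^2)
  by_cases h : |r - b| < δ
  · have := hball (y := r) (by rwa [Real.dist_eq])
    rw [h0, sub_zero, Real.norm_eq_abs, Real.norm_eq_abs] at this
    have h2 := near_bound b r hb hr
    calc |φ r| ≤ c * |r - b| := this
      _ ≤ |c| * |r-b| := by gcongr; exact le_abs_self _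
      _ = |c| / b * (b * |r - b|) := by field_simp
      _ ≤ |c| / b * |r^2-b^2| := by gcongr
      _ ≤ _ := by gcongr; nlinarith
  · push Not at h
    calc |φ r| ≤ M * (1 + r^2) := hM r hr
      _ ≤ M * (C * |r^2-b^2|) := by gcongr; exact hfar r hr h
      _ = M * C * |r^2-b^2| := by ring
      _ ≤ _ := by gcongr; have : 0 ≤ |c| / b := by positivity
                  linarith

lemma quad_global (φ ψ : ℝ → ℝ) (b d M : ℝ) (hb : 0 < b) (h0 : φ b = 0) (h1 : ψ b = 0)
    (hφ : ∀ r, 0 < r → HasDerivAt φ (ψ r) r) (hd : HasDerivAt ψ d b)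
    (hM : ∀ r, 0 ≤ r → |φ r| ≤ M * (1 + r^2)) (hM0 : 0 ≤ M) :
    ∃ C > 0, ∀ r, 0 ≤ r → |φ r| ≤ C * (r^2 - b^2)^2 := by
  obtain ⟨c, hc⟩ := hd.isBigO_sub.bound
  obtain ⟨δ', hδ', hball⟩ := Metric.eventually_nhds_iff.1 hc
  set δ := min δ' b with hδdef
  have hδ : 0 < δ := lt_min hδ' hb
  obtain ⟨C, hC, hfar⟩ := far_bound2 b δ hb hδ
  refine ⟨|c| / b^2 + M * C + 1, by positivity, fun r hr => ?_⟩
  have hx := sq_nonneg (r^2-b^2)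
  by_cases h : |r - b| < δ
  · have h2 := near_bound b r hb hr
    have key : ‖φ r - φ b‖ ≤ |c| * |r - b| * ‖r - b‖ := by
      have hs : ∀ x ∈ Set.uIcc b r, 0 < x ∧ |x - b| ≤ |r - b| := by
        intro x hx
        have h3 := Set.abs_sub_left_of_mem_uIcc hx
        refine ⟨?_, h3⟩
        have := (h3.trans_lt h).trans_le (min_le_right _ _)
        linarith [(abs_lt.1 this).1]
      refine Convex.norm_image_sub_le_of_norm_hasDerivWithin_le (f := φ) (f' := ψ) (s := Set.uIcc b r)
        (fun x hx => (hφ x (hs x hx).1).hasDerivWithinAt) ?_ (convex_uIcc b r) Set.left_mem_uIcc Set.right_mem_uIcc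
      intro x hx
      have h3 := hs x hx
      have := hball (y := x) (by rw [Real.dist_eq]; exact (h3.2.trans_lt h).trans_le (min_le_left _ _))
      rw [h1, sub_zero] at this
      refine this.trans ?_
      rw [Real.norm_eq_abs]
      exact mul_le_mul (le_abs_self c) h3.2 (abs_nonneg _) (abs_nonneg _)
    rw [h0, sub_zero, Real.norm_eq_abs, Real.norm_eq_abs] at key
    calc |φ r| ≤ |c| * |r - b| * |r-b| := key
      _ = |c| / b^2 * (b * |r - b|)^2 := by field_simp
      _ ≤ |c| / b^2 * |r^2-b^2|^2 := by gcongr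
      _ = |c| / b^2 * (r^2-b^2)^2 := by rw [sq_abs]
      _ ≤ _ := by gcongr; nlinarith
  · push Not at h
    calc |φ r| ≤ M * (1 + r^2) := hM r hr
      _ ≤ M * (C * (r^2-b^2)^2) := by gcongr; exact hfar r hr h
      _ = M * C * (r^2-b^2)^2 := by ring
      _ ≤ _ := by gcongr; have : 0 ≤ |c| / b^2 := by positivity
                  linarith

lemma Kf_strictAnti (N : ℕ) (hN : 2 ≤ N) : StrictAntiOn (Kf N) (Set.Ici 0) := by
  apply strictAntiOn_of_deriv_neg (convex_Ici 0)
  · exact (Kf_continuous N hN).continuousOn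
  · intro x hx
    rw [interior_Ici] at hx
    rw [(Kf_hasDerivAt N hN x hx).deriv]
    exact div_neg_of_neg_of_pos (Kf_neg N hN x hx) hx

/-- the derivative of `K` -/
def Kd (N : ℕ) (r : ℝ) : ℝ := (1 - N * Kf N r - r^2 * Kf N r ^ 2) / r

lemma Kd_neg (N : ℕ) (hN : 2 ≤ N) (r : ℝ) (hr : 0 < r) : Kd N r < 0 :=
  div_neg_of_neg_of_pos (Kf_neg N hN r hr) hr

lemma K_coercive (N : ℕ) (hN : 2 ≤ N) (b : ℝ) (hb : 0 < b) :
    ∃ c > 0, ∀ r, 0 ≤ r → c * (r^2-b^2)^2 ≤ (Kf N b - Kf N r) * (r^2-b^2) * (1 + r^2) := by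
  have hkd := Kd_neg N hN b hb
  have hd : HasDerivAt (Kf N) (Kd N b) b := Kf_hasDerivAt N hN b hb
  have h1 := (hasDerivAt_iff_isLittleO.1 hd).def (c := -Kd N b / 2) (by linarith)
  obtain ⟨δ', hδ', hball⟩ := Metric.eventually_nhds_iff.1 h1
  set δ := min δ' b with hδdef
  have hδ : 0 < δ := lt_min hδ' hb
  have hδb : δ ≤ b := min_le_right _ _
  have hanti := Kf_strictAnti N hN
  have hη1 : 0 < Kf N b - Kf N (b + δ) := by
    linarith [hanti (Set.mem_Ici.2 hb.le) (Set.mem_Ici.2 (by linarith : 0 ≤ b + δ)) (by linarith)]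
  have hη2 : 0 < Kf N (b - δ) - Kf N b := by
    linarith [hanti (Set.mem_Ici.2 (by linarith : 0 ≤ b - δ)) (Set.mem_Ici.2 hb.le) (by linarith)]
  set η := min (Kf N b - Kf N (b + δ)) (Kf N (b - δ) - Kf N b) with hη
  have hη0 : 0 < η := lt_min hη1 hη2
  set c1 := -Kd N b / 2 / (3 * b) with hc1
  have hc1p : 0 < c1 := by rw [hc1]; apply div_pos <;> linarith
  set c2 := η / (1 + b^2) with hc2
  have hc2p : 0 < c2 := by positivity
  refine ⟨min c1 c2, lt_min hc1p hc2p, fun r hr => ?_⟩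
  have hfac : r^2 - b^2 = (r - b) * (r + b) := by ring
  by_cases h : |r - b| < δ
  · have := hball (y := r) (by rw [Real.dist_eq]; exact h.trans_le (min_le_left _ _))
    rw [Real.norm_eq_abs, Real.norm_eq_abs, smul_eq_mul] at this
    have h2 : -Kd N b / 2 * (r-b)^2 ≤ (Kf N b - Kf N r) * (r-b) := by
      have h3 : |(Kf N r - Kf N b - (r - b) * Kd N b) * (r-b)| ≤ -Kd N b / 2 * (r-b)^2 := by
        rw [abs_mul, ← sq_abs (r-b)]; nlinarith [abs_nonneg (r-b)]
      have h4 := (abs_le.1 h3).2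
      nlinarith
    have hrb : r + b ≤ 3 * b := by linarith [(abs_lt.1 h).2]
    calc min c1 c2 * (r^2-b^2)^2 ≤ c1 * (r^2-b^2)^2 := by gcongr; exact min_le_left _ _
      _ = c1 * (r+b) * ((r-b)^2 * (r+b)) := by ring
      _ ≤ c1 * (3 * b) * ((r-b)^2 * (r+b)) := by gcongr
      _ = (-Kd N b / 2 * (r-b)^2) * (r+b) := by rw [hc1]; field_simp
      _ ≤ ((Kf N b - Kf N r) * (r-b)) * (r+b) := by gcongr
      _ ≤ ((Kf N b - Kf N r) * (r-b)) * (r+b) * (1 + r^2) := by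
          apply le_mul_of_one_le_right
          · refine mul_nonneg (le_trans ?_ h2) (by linarith)
            exact mul_nonneg (by linarith) (sq_nonneg _)
          · nlinarith [sq_nonneg r]
      _ = _ := by ring
  · push Not at h
    have h5 : η * |r^2-b^2| ≤ (Kf N b - Kf N r) * (r^2-b^2) := by
      rcases le_abs.1 h with h | h
      · have : Kf N r ≤ Kf N (b+δ) := hanti.antitoneOn (Set.mem_Ici.2 (by linarith)) (Set.mem_Ici.2 hr) (by linarith)
        have hp : 0 ≤ r^2-b^2 := by rw [hfac]; apply mul_nonneg <;> linarith
        rw [abs_of_nonneg hp]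
        gcongr
        exact (min_le_left _ _).trans (by linarith)
      · have : Kf N (b-δ) ≤ Kf N r := hanti.antitoneOn (Set.mem_Ici.2 hr) (Set.mem_Ici.2 (by linarith)) (by linarith)
        have hp : r^2-b^2 ≤ 0 := by rw [hfac]; apply mul_nonpos_of_nonpos_of_nonneg <;> linarith
        rw [abs_of_nonpos hp]
        have : η ≤ Kf N r - Kf N b := (min_le_right _ _).trans (by linarith)
        nlinarith
    have h6 : |r^2-b^2| ≤ (1 + b^2) * (1 + r^2) := by
      rw [abs_le]; constructor <;> nlinarith [sq_nonneg r, sq_nonneg b, mul_nonneg (sq_nonneg r) (sq_nonneg b)]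
    calc min c1 c2 * (r^2-b^2)^2 ≤ c2 * (r^2-b^2)^2 := by gcongr; exact min_le_right _ _
      _ = c2 * |r^2-b^2| * |r^2-b^2| := by rw [← sq_abs]; ring
      _ ≤ c2 * |r^2-b^2| * ((1 + b^2) * (1 + r^2)) := by gcongr
      _ = η * |r^2-b^2| * (1 + r^2) := by rw [hc2]; field_simp
      _ ≤ _ := by gcongr

lemma K_quad (N : ℕ) (hN : 2 ≤ N) (b : ℝ) (hb : 0 < b) :
    ∃ C > 0, ∀ r, 0 ≤ r →
      |(Kf N b - Kf N r) * r^2 - (-Kd N b * b / 2) * (r^2 - b^2)| ≤ C * (r^2-b^2)^2 := by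
  have hd := Kf_hasDerivAt N hN b hb
  have hid := hasDerivAt_id b
  have e1 : HasDerivAt (fun r => -(r * (1 - N * Kf N r - r^2 * Kf N r ^ 2)) + (Kf N b - Kf N r) * (2 * r) - (-Kd N b * b / 2) * (2 * r)) _ b :=
      ((hid.mul ((((hd.const_mul (N:ℝ)).const_sub 1)).sub ((hasDerivAt_pow 2 b).mul (hd.pow 2)))).neg.add
        ((hd.const_sub (Kf N b)).mul (hid.const_mul 2))).sub ((hid.const_mul 2).const_mul _)
  refine quad_global (fun r => (Kf N b - Kf N r) * r^2 - (-Kd N b * b / 2) * (r^2 - b^2))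
    (fun r => -(r * (1 - N * Kf N r - r^2 * Kf N r ^ 2)) + (Kf N b - Kf N r) * (2 * r) - (-Kd N b * b / 2) * (2 * r))
    b _ (2 + |-Kd N b * b / 2| * (1 + b^2)) hb (by simp) ?_ ?_ e1 ?_ (by positivity)
  · simp only [Kd]; field_simp; ring
  · intro r hr
    have h1 := (((Kf_hasDerivAt N hN r hr).const_sub (Kf N b)).mul (hasDerivAt_pow 2 r)).sub
      (((hasDerivAt_pow 2 r).sub_const (b^2)).const_mul (-Kd N b * b / 2))
    refine h1.congr_deriv ?_
    field_simp
    push_cast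
    ring
  · intro r hr
    have h1 : |Kf N b - Kf N r| ≤ 2 := by
      have := Kf_pos N hN b; have := Kf_pos N hN r
      have := Kf_le_one N hN b; have := Kf_le_one N hN r
      rw [abs_le]; constructor <;> linarith
    have h2 : |r^2-b^2| ≤ (1+b^2) * (1 + r^2) := by
      rw [abs_le]; constructor <;> nlinarith [sq_nonneg r, sq_nonneg b, mul_nonneg (sq_nonneg r) (sq_nonneg b)]
    calc |(Kf N b - Kf N r) * r^2 - (-Kd N b * b / 2) * (r^2 - b^2)|
        ≤ |(Kf N b - Kf N r) * r^2| + |(-Kd N b * b / 2) * (r^2 - b^2)| := abs_sub _ _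
      _ = |Kf N b - Kf N r| * r^2 + |(-Kd N b * b / 2)| * |(r^2 - b^2)| := by
          rw [abs_mul, abs_mul, abs_of_nonneg (sq_nonneg r)]
      _ ≤ 2 * (1 + r^2) + |(-Kd N b * b / 2)| * ((1+b^2) * (1 + r^2)) := by gcongr; linarith
      _ = _ := by ring

lemma V_lip (N : ℕ) (hN : 2 ≤ N) (b : ℝ) (hb : 0 < b) :
    ∃ C > 0, ∀ r, 0 ≤ r → |r^2 * Vf N r - b^2 * Vf N b| ≤ C * |r^2-b^2| := by
  have hd := Kf_hasDerivAt N hN b hb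
  have e1 : HasDerivAt (fun r => r^2 * Vf N r - b^2 * Vf N b) _ b :=
    ((hasDerivAt_pow 2 b).mul (((hd.const_mul ((N:ℝ) - 1)).const_sub 1).sub ((hasDerivAt_pow 2 b).mul (hd.pow 2)))).sub_const _
  refine lin_global _ b _ (1 + b^2) hb (by simp) e1 ?_ (by positivity)
  intro r hr
  have h1 := Vf_abs_le N hN r hr
  have h2 := Vf_abs_le N hN b hb.le
  calc |r^2 * Vf N r - b^2 * Vf N b| ≤ |r^2 * Vf N r| + |b^2 * Vf N b| := abs_sub _ _
    _ = r^2 * |Vf N r| + b^2 * |Vf N b| := by rw [abs_mul, abs_mul, abs_of_nonneg (sq_nonneg r), abs_of_nonneg (sq_nonneg b)]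
    _ ≤ r^2 * 1 + b^2 * 1 := by gcongr
    _ ≤ _ := by nlinarith [sq_nonneg r, sq_nonneg b, mul_nonneg (sq_nonneg r) (sq_nonneg b)]

lemma besselRatio_deriv (N : ℕ) (hN : 2 ≤ N) (b : ℝ) (hb : 0 < b) :
    deriv (besselRatio N) b = Kf N b + b * Kd N b := by
  have h : besselRatio N = fun x => x * Kf N x := funext fun x => besselRatio_eq N x
  rw [h]
  have := ((hasDerivAt_id b).mul (Kf_hasDerivAt N hN b hb)).deriv
  simp only [id, one_mul] at this
  exact this

end PartB

noncomputable section PartC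

variable {N : ℕ}

lemma sphereMap_continuous
    (e : EuclideanSpace ℝ (Fin N) ≃ₗᵢ[ℝ] EuclideanSpace ℝ (Fin N)) : Continuous (sphereMap e) := by
  unfold sphereMap
  exact Continuous.subtype_mk (e.continuous.comp continuous_subtype_val) _

lemma rot_integral (μ : Measure (UnitSphere N)) [IsProbabilityMeasure μ]
    (hμinv : ∀ e : EuclideanSpace ℝ (Fin N) ≃ₗᵢ[ℝ] EuclideanSpace ℝ (Fin N),
      Measure.map (sphereMap e) μ = μ) (φ : ℝ → ℝ) (hφ : Continuous φ)
    (y y' : EuclideanSpace ℝ (Fin N)) (h : ‖y‖ = ‖y'‖) :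
    ∫ x : UnitSphere N, φ ⟪y, (x : EuclideanSpace ℝ (Fin N))⟫ ∂μ
      = ∫ x : UnitSphere N, φ ⟪y', (x : EuclideanSpace ℝ (Fin N))⟫ ∂μ := by
  set e := Submodule.reflection (ℝ ∙ (y - y'))ᗮ with he
  have hey : e y = y' := Submodule.reflection_sub h
  have hc : Continuous fun x : UnitSphere N => φ ⟪y', (x : EuclideanSpace ℝ (Fin N))⟫ := by fun_prop
  conv_rhs => rw [← hμinv e]
  rw [integral_map (sphereMap_continuous e).measurable.aemeasurable hc.aestronglyMeasurable]
  congr 1; ext x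
  have : ((sphereMap e x : UnitSphere N) : EuclideanSpace ℝ (Fin N)) = e x := rfl
  rw [this, ← hey, e.inner_map_map]

/-- radial Laplace transform -/
def zr (μ : Measure (UnitSphere N)) (i : Fin N) (r : ℝ) : ℝ :=
  ∫ x : UnitSphere N, exp (r * (x : EuclideanSpace ℝ (Fin N)) i) ∂μ

def zr1 (μ : Measure (UnitSphere N)) (i : Fin N) (r : ℝ) : ℝ :=
  ∫ x : UnitSphere N, (x : EuclideanSpace ℝ (Fin N)) i * exp (r * (x : EuclideanSpace ℝ (Fin N)) i) ∂μ

def zr2 (μ : Measure (UnitSphere N)) (i : Fin N) (r : ℝ) : ℝ :=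
  ∫ x : UnitSphere N, (x : EuclideanSpace ℝ (Fin N)) i ^ 2 * exp (r * (x : EuclideanSpace ℝ (Fin N)) i) ∂μ

lemma coord_continuous (i : Fin N) :
    Continuous fun x : UnitSphere N => (x : EuclideanSpace ℝ (Fin N)) i := by fun_prop

lemma sph_norm (x : UnitSphere N) : ‖(x : EuclideanSpace ℝ (Fin N))‖ = 1 :=
  mem_sphere_zero_iff_norm.mp x.2

lemma coord_le (x : UnitSphere N) (i : Fin N) : |(x : EuclideanSpace ℝ (Fin N)) i| ≤ 1 := by
  have := PiLp.norm_apply_le (x : EuclideanSpace ℝ (Fin N)) i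
  rwa [sph_norm, Real.norm_eq_abs] at this

lemma cont_integrable (μ : Measure (UnitSphere N)) [IsProbabilityMeasure μ] (φ : UnitSphere N → ℝ)
    (hφ : Continuous φ) : Integrable φ μ :=
  hφ.integrable_of_hasCompactSupport (HasCompactSupport.of_compactSpace φ)

lemma zr_pos (μ : Measure (UnitSphere N)) [IsProbabilityMeasure μ] (i : Fin N) (r : ℝ) : 0 < zr μ i r := by
  have hc : Continuous fun x : UnitSphere N => r * (x : EuclideanSpace ℝ (Fin N)) i := by fun_prop
  exact integral_exp_pos (cont_integrable μ _ (by fun_prop))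

lemma zr_hasDerivAt (μ : Measure (UnitSphere N)) [IsProbabilityMeasure μ] (i : Fin N) (r : ℝ) :
    HasDerivAt (zr μ i) (zr1 μ i r) r := by
  have := aux_hasDerivAt_expint μ (fun x : UnitSphere N => (x : EuclideanSpace ℝ (Fin N)) i) (fun _ => 1)
    (coord_continuous i).measurable (by fun_prop) 1 (.of_forall fun x => coord_le x i)
    (.of_forall fun x => by simp) r
  simp only [one_mul] at this
  exact this

lemma zr1_hasDerivAt (μ : Measure (UnitSphere N)) [IsProbabilityMeasure μ] (i : Fin N) (r : ℝ) :
    HasDerivAt (zr1 μ i) (zr2 μ i r) r := by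
  have := aux_hasDerivAt_expint μ (fun x : UnitSphere N => (x : EuclideanSpace ℝ (Fin N)) i)
    (fun x : UnitSphere N => (x : EuclideanSpace ℝ (Fin N)) i)
    (coord_continuous i).measurable (coord_continuous i).measurable 1 (.of_forall fun x => coord_le x i)
    (.of_forall fun x => coord_le x i) r
  simp only [← sq] at this
  exact this

lemma zr_mixed (μ : Measure (UnitSphere N)) [IsProbabilityMeasure μ]
    (hμinv : ∀ e : EuclideanSpace ℝ (Fin N) ≃ₗᵢ[ℝ] EuclideanSpace ℝ (Fin N),
      Measure.map (sphereMap e) μ = μ) (i j : Fin N) (hij : i ≠ j) (r t : ℝ) :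
    ∫ x : UnitSphere N, exp (r * (x : EuclideanSpace ℝ (Fin N)) i) * exp (t * (x : EuclideanSpace ℝ (Fin N)) j) ∂μ
      = zr μ i (√(r^2+t^2)) := by
  have h := rot_integral μ hμinv exp continuous_exp
    (EuclideanSpace.single i r + EuclideanSpace.single j t) (EuclideanSpace.single i (√(r^2+t^2))) ?_
  · simp only [inner_add_left, EuclideanSpace.inner_single_left, conj_trivial, exp_add] at h
    exact h
  · have h0 : ⟪EuclideanSpace.single i r, EuclideanSpace.single j t⟫ = 0 := by
      simp [EuclideanSpace.inner_single_left, hij]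
    have h1 := norm_add_sq_eq_norm_sq_add_norm_sq_real h0
    have h2 : ‖EuclideanSpace.single i r + EuclideanSpace.single j t‖ ^ 2 = r^2 + t^2 := by
      rw [sq, h1]; simp [sq]
    rw [← h2, Real.sqrt_sq (norm_nonneg _)]
    simp

lemma zr_cross (μ : Measure (UnitSphere N)) [IsProbabilityMeasure μ]
    (hμinv : ∀ e : EuclideanSpace ℝ (Fin N) ≃ₗᵢ[ℝ] EuclideanSpace ℝ (Fin N),
      Measure.map (sphereMap e) μ = μ) (i j : Fin N) (hij : i ≠ j) (r : ℝ) (hr : 0 < r) :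
    ∫ x : UnitSphere N, exp (r * (x : EuclideanSpace ℝ (Fin N)) i) * (x : EuclideanSpace ℝ (Fin N)) j ^ 2 ∂μ
      = zr1 μ i r / r := by
  have hm : Measurable fun x : UnitSphere N => exp (r * (x : EuclideanSpace ℝ (Fin N)) i) :=
    (by fun_prop : Continuous fun x : UnitSphere N => exp (r * (x : EuclideanSpace ℝ (Fin N)) i)).measurable
  have hmb : ∀ x : UnitSphere N, |exp (r * (x : EuclideanSpace ℝ (Fin N)) i)| ≤ exp r := by
    intro x
    rw [abs_of_pos (exp_pos _), exp_le_exp]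
    have := (abs_le.1 (coord_le x i)).2
    nlinarith
  have h1 : ∀ t, HasDerivAt (fun t => zr μ i (√(r^2+t^2)))
      (∫ x : UnitSphere N, exp (r * (x : EuclideanSpace ℝ (Fin N)) i) * (x : EuclideanSpace ℝ (Fin N)) j *
        exp (t * (x : EuclideanSpace ℝ (Fin N)) j) ∂μ) t := by
    intro t
    have := aux_hasDerivAt_expint μ (fun x : UnitSphere N => (x : EuclideanSpace ℝ (Fin N)) j)
      (fun x : UnitSphere N => exp (r * (x : EuclideanSpace ℝ (Fin N)) i))
      (coord_continuous j).measurable hm (exp r) (.of_forall fun x => coord_le x j) (.of_forall hmb) t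
    simpa only [zr_mixed μ hμinv i j hij] using this
  have hpos : ∀ t : ℝ, 0 < r^2 + t^2 := fun t => by positivity
  have hs : ∀ t : ℝ, HasDerivAt (fun t => √(r^2+t^2)) (2 * t / (2 * √(r^2+t^2))) t := by
    intro t
    have := ((hasDerivAt_pow 2 t).const_add (r^2)).sqrt (hpos t).ne'
    simpa using this
  have h2 : ∀ t, HasDerivAt (fun t => zr μ i (√(r^2+t^2))) (zr1 μ i (√(r^2+t^2)) * (2 * t / (2 * √(r^2+t^2)))) t :=
    fun t => (zr_hasDerivAt μ i _).comp t (hs t)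
  have h3 : (fun t => ∫ x : UnitSphere N, exp (r * (x : EuclideanSpace ℝ (Fin N)) i) * (x : EuclideanSpace ℝ (Fin N)) j *
        exp (t * (x : EuclideanSpace ℝ (Fin N)) j) ∂μ) = fun t => t * (zr1 μ i (√(r^2+t^2)) / √(r^2+t^2)) := by
    ext t
    rw [(h1 t).unique (h2 t)]
    have : √(r^2+t^2) ≠ 0 := (Real.sqrt_pos.2 (hpos t)).ne'
    field_simp
  have h4 := aux_hasDerivAt_expint μ (fun x : UnitSphere N => (x : EuclideanSpace ℝ (Fin N)) j)
      (fun x : UnitSphere N => exp (r * (x : EuclideanSpace ℝ (Fin N)) i) * (x : EuclideanSpace ℝ (Fin N)) j)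
      (coord_continuous j).measurable (hm.mul (coord_continuous j).measurable) (exp r) (.of_forall fun x => coord_le x j)
      (.of_forall fun x => by
        rw [abs_mul]
        calc _ ≤ exp r * 1 := mul_le_mul (hmb x) (coord_le x j) (abs_nonneg _) (exp_pos _).le
          _ = _ := mul_one _) 0
  rw [h3] at h4
  have h5 := (hasDerivAt_id (0:ℝ)).mul ((((zr1_hasDerivAt μ i _).comp 0 (hs 0)).div (hs 0))
    (Real.sqrt_pos.2 (hpos 0)).ne')
  have h6 := h4.unique h5
  simp only [zero_mul, exp_zero, mul_one, id, one_mul, add_zero, Pi.div_apply, Function.comp, ne_eq,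
    OfNat.ofNat_ne_zero, not_false_eq_true, zero_pow, Real.sqrt_sq hr.le] at h6
  rw [← h6]
  congr 1; ext x; ring

lemma zr_ode (hN : 2 ≤ N) (μ : Measure (UnitSphere N)) [IsProbabilityMeasure μ]
    (hμinv : ∀ e : EuclideanSpace ℝ (Fin N) ≃ₗᵢ[ℝ] EuclideanSpace ℝ (Fin N),
      Measure.map (sphereMap e) μ = μ) (i : Fin N) (r : ℝ) (hr : 0 < r) :
    zr μ i r = zr2 μ i r + ((N:ℝ) - 1) * (zr1 μ i r / r) := by
  have h1 : ∀ x : UnitSphere N, exp (r * (x : EuclideanSpace ℝ (Fin N)) i)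
      = ∑ j, exp (r * (x : EuclideanSpace ℝ (Fin N)) i) * (x : EuclideanSpace ℝ (Fin N)) j ^ 2 := by
    intro x
    rw [← Finset.mul_sum, ← EuclideanSpace.real_norm_sq_eq, sph_norm]; simp
  have h2 : zr μ i r = ∑ j, ∫ x : UnitSphere N, exp (r * (x : EuclideanSpace ℝ (Fin N)) i) * (x : EuclideanSpace ℝ (Fin N)) j ^ 2 ∂μ := by
    rw [← integral_finsetSum]
    · exact integral_congr_ae (.of_forall h1)
    · intro j _
      exact cont_integrable μ _ (by fun_prop)
  rw [h2, ← Finset.add_sum_erase _ _ (Finset.mem_univ i)]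
  congr 1
  · unfold zr2; congr 1; ext x; ring
  · rw [Finset.sum_congr rfl fun j hj => zr_cross μ hμinv i j (Finset.ne_of_mem_erase hj).symm r hr,
      Finset.sum_const, Finset.card_erase_of_mem (Finset.mem_univ i), Finset.card_univ, Fintype.card_fin,
      nsmul_eq_mul, Nat.cast_sub (by omega), Nat.cast_one]

lemma zr_log_deriv (hN : 2 ≤ N) (μ : Measure (UnitSphere N)) [IsProbabilityMeasure μ]
    (hμinv : ∀ e : EuclideanSpace ℝ (Fin N) ≃ₗᵢ[ℝ] EuclideanSpace ℝ (Fin N),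
      Measure.map (sphereMap e) μ = μ) (i : Fin N) (r : ℝ) (hr : 0 < r) :
    zr1 μ i r = r * Kf N r * zr μ i r := by
  obtain ⟨k, rfl⟩ := Nat.exists_eq_add_of_le hN
  set J := sI (2 + k - 2) with hJ
  set J1 := fun x => x / (((2+k:ℕ):ℝ) - 1) * sI (2+k) x with hJ1
  have hdJ : ∀ x, HasDerivAt J (J1 x) x := fun x => sI_hasDerivAt _ hN x
  have hdJ1 : ∀ x, HasDerivAt J1 (J x - sI (2+k) x) x := fun x => sI_hasDerivAt2 _ hN x
  have hA : ∀ x, x * sI (2+k) x = (k+1) * J1 x := by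
    intro x
    have : ((2+k:ℕ):ℝ) - 1 = k + 1 := by push_cast; ring
    simp only [hJ1, this]
    have : (k:ℝ) + 1 ≠ 0 := by positivity
    field_simp
  let T : ℝ → ℝ := fun x => x^(k+1) * (zr1 μ i x * J x - zr μ i x * J1 x)
  have hT : ∀ x, HasDerivAt T (((k+1:ℕ):ℝ) * x^k * (zr1 μ i x * J x - zr μ i x * J1 x) +
      x^(k+1) * ((zr2 μ i x * J x + zr1 μ i x * J1 x) - (zr1 μ i x * J1 x + zr μ i x * (J x - sI (2+k) x)))) x := by
    intro x
    exact (hasDerivAt_pow (k+1) x).mul (((zr1_hasDerivAt μ i x).mul (hdJ x)).sub ((zr_hasDerivAt μ i x).mul (hdJ1 x)))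
  have hT0 : ∀ x, 0 < x → HasDerivAt T 0 x := by
    intro x hx
    refine (hT x).congr_deriv ?_
    have h1 := zr_ode hN μ hμinv i x hx
    have h2 := hA x
    have h3 : x * zr2 μ i x = x * zr μ i x - (k+1) * zr1 μ i x := by
      rw [h1]; push_cast; field_simp; ring
    clear_value J1
    push_cast
    rw [pow_succ]
    linear_combination x^k * J x * h3 + x^k * zr μ i x * h2
  have hTr : T r = T 0 := by
    refine (constant_of_has_deriv_right_zero (f := T) (a := 0) (b := r)
      (fun x _ => (hT x).continuousAt.continuousWithinAt) ?_) r (Set.right_mem_Icc.2 hr.le)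
    intro x hx
    rcases eq_or_lt_of_le hx.1 with h | h
    · subst h
      refine ((hT 0).congr_deriv ?_).hasDerivWithinAt
      have hJ0 : J1 0 = 0 := by simp [hJ1]
      have hz : zr1 μ i 0 = 0 := by
        have h := rot_integral μ hμinv id continuous_id (EuclideanSpace.single i (1:ℝ)) (-EuclideanSpace.single i (1:ℝ)) (by simp)
        simp only [inner_neg_left, EuclideanSpace.inner_single_left, conj_trivial, one_mul, id, integral_neg] at h
        simp only [zr1, zero_mul, exp_zero, mul_one]
        linarith
      rw [hJ0, hz]
      simp
    · exact (hT0 x h).hasDerivWithinAt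
  have : T 0 = 0 := by simp [T]
  rw [this] at hTr
  have hz : zr1 μ i r * J r - zr μ i r * J1 r = 0 := by
    rcases mul_eq_zero.1 hTr with h | h
    · exact absurd h (by positivity)
    · exact h
  have hJr : 0 < J r := sI_pos _ _
  have e : J1 r = r * Kf (2+k) r * J r := sI_J1 _ hN r
  rw [e] at hz
  have : (zr1 μ i r - r * Kf (2+k) r * zr μ i r) * J r = 0 := by linarith
  rcases mul_eq_zero.1 this with h | h
  · linarith
  · exact absurd h hJr.ne'

lemma zr_second (hN : 2 ≤ N) (μ : Measure (UnitSphere N)) [IsProbabilityMeasure μ]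
    (hμinv : ∀ e : EuclideanSpace ℝ (Fin N) ≃ₗᵢ[ℝ] EuclideanSpace ℝ (Fin N),
      Measure.map (sphereMap e) μ = μ) (i : Fin N) (r : ℝ) (hr : 0 < r) :
    zr2 μ i r = (1 - ((N:ℝ) - 1) * Kf N r) * zr μ i r := by
  have h1 := zr_ode hN μ hμinv i r hr
  rw [zr_log_deriv hN μ hμinv i r hr] at h1
  have : r * Kf N r * zr μ i r / r = Kf N r * zr μ i r := by field_simp
  rw [this] at h1
  linarith

lemma sph_Z (μ : Measure (UnitSphere N)) [IsProbabilityMeasure μ]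
    (hμinv : ∀ e : EuclideanSpace ℝ (Fin N) ≃ₗᵢ[ℝ] EuclideanSpace ℝ (Fin N),
      Measure.map (sphereMap e) μ = μ) (i : Fin N) (y : EuclideanSpace ℝ (Fin N)) :
    ∫ x : UnitSphere N, exp ⟪y, (x : EuclideanSpace ℝ (Fin N))⟫ ∂μ = zr μ i ‖y‖ := by
  rw [rot_integral μ hμinv exp continuous_exp y (EuclideanSpace.single i ‖y‖) (by simp)]
  simp only [EuclideanSpace.inner_single_left, conj_trivial, zr]

lemma sph_m1 (hN : 2 ≤ N) (μ : Measure (UnitSphere N)) [IsProbabilityMeasure μ]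
    (hμinv : ∀ e : EuclideanSpace ℝ (Fin N) ≃ₗᵢ[ℝ] EuclideanSpace ℝ (Fin N),
      Measure.map (sphereMap e) μ = μ) (y : EuclideanSpace ℝ (Fin N)) :
    ∫ x : UnitSphere N, (⟪y, (x : EuclideanSpace ℝ (Fin N))⟫ - ‖y‖^2 * Kf N ‖y‖) *
      exp ⟪y, (x : EuclideanSpace ℝ (Fin N))⟫ ∂μ = 0 := by
  rcases eq_or_ne y 0 with rfl | hy
  · simp
  let i : Fin N := ⟨0, by omega⟩
  have hr : 0 < ‖y‖ := norm_pos_iff.2 hy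
  rw [rot_integral μ hμinv (fun t => (t - ‖y‖^2 * Kf N ‖y‖) * exp t) (by fun_prop) y (EuclideanSpace.single i ‖y‖) (by simp)]
  simp only [EuclideanSpace.inner_single_left, conj_trivial]
  have e : ∀ x : UnitSphere N, (‖y‖ * (x : EuclideanSpace ℝ (Fin N)) i - ‖y‖^2 * Kf N ‖y‖) * exp (‖y‖ * (x : EuclideanSpace ℝ (Fin N)) i)
      = ‖y‖ * ((x : EuclideanSpace ℝ (Fin N)) i * exp (‖y‖ * (x : EuclideanSpace ℝ (Fin N)) i)) -
        ‖y‖^2 * Kf N ‖y‖ * exp (‖y‖ * (x : EuclideanSpace ℝ (Fin N)) i) := fun x => by ring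
  simp only [e]
  rw [integral_sub (cont_integrable μ _ (by fun_prop)) (cont_integrable μ _ (by fun_prop)),
    integral_const_mul, integral_const_mul]
  have h := zr_log_deriv hN μ hμinv i _ hr
  unfold zr1 at h
  rw [h]
  unfold zr
  ring

lemma sph_m2 (hN : 2 ≤ N) (μ : Measure (UnitSphere N)) [IsProbabilityMeasure μ]
    (hμinv : ∀ e : EuclideanSpace ℝ (Fin N) ≃ₗᵢ[ℝ] EuclideanSpace ℝ (Fin N),
      Measure.map (sphereMap e) μ = μ) (y : EuclideanSpace ℝ (Fin N)) :
    ∫ x : UnitSphere N, ((⟪y, (x : EuclideanSpace ℝ (Fin N))⟫ - ‖y‖^2 * Kf N ‖y‖) *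
      ⟪y, (x : EuclideanSpace ℝ (Fin N))⟫ - ‖y‖^2 * Vf N ‖y‖) *
      exp ⟪y, (x : EuclideanSpace ℝ (Fin N))⟫ ∂μ = 0 := by
  rcases eq_or_ne y 0 with rfl | hy
  · simp
  let i : Fin N := ⟨0, by omega⟩
  have hr : 0 < ‖y‖ := norm_pos_iff.2 hy
  rw [rot_integral μ hμinv (fun t => ((t - ‖y‖^2 * Kf N ‖y‖) * t - ‖y‖^2 * Vf N ‖y‖) * exp t) (by fun_prop) y (EuclideanSpace.single i ‖y‖) (by simp)]
  simp only [EuclideanSpace.inner_single_left, conj_trivial]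
  have e : ∀ x : UnitSphere N, ((‖y‖ * (x : EuclideanSpace ℝ (Fin N)) i - ‖y‖^2 * Kf N ‖y‖) *
       (‖y‖ * (x : EuclideanSpace ℝ (Fin N)) i) - ‖y‖^2 * Vf N ‖y‖) * exp (‖y‖ * (x : EuclideanSpace ℝ (Fin N)) i)
      = ‖y‖^2 * ((x : EuclideanSpace ℝ (Fin N)) i ^ 2 * exp (‖y‖ * (x : EuclideanSpace ℝ (Fin N)) i)) -
        ‖y‖^3 * Kf N ‖y‖ * ((x : EuclideanSpace ℝ (Fin N)) i * exp (‖y‖ * (x : EuclideanSpace ℝ (Fin N)) i)) -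
        ‖y‖^2 * Vf N ‖y‖ * exp (‖y‖ * (x : EuclideanSpace ℝ (Fin N)) i) := fun x => by ring
  simp only [e]
  rw [integral_sub (cont_integrable μ _ (by fun_prop)) (cont_integrable μ _ (by fun_prop)),
    integral_sub (cont_integrable μ _ (by fun_prop)) (cont_integrable μ _ (by fun_prop)),
    integral_const_mul, integral_const_mul, integral_const_mul]
  have h := zr_log_deriv hN μ hμinv i _ hr
  have h2 := zr_second hN μ hμinv i _ hr
  unfold zr1 at h
  unfold zr2 at h2
  rw [h, h2]
  unfold zr Vf
  ring

lemma zr_le (μ : Measure (UnitSphere N)) [IsProbabilityMeasure μ] (i : Fin N) (r : ℝ) (hr : 0 ≤ r) :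
    zr μ i r ≤ exp r := by
  have : zr μ i r ≤ ∫ x : UnitSphere N, exp r ∂μ := by
    refine integral_mono (cont_integrable μ _ (by fun_prop)) (integrable_const _) fun x => ?_
    simp only [exp_le_exp]
    have := (abs_le.1 (coord_le x i)).2
    nlinarith
  simpa using this

end PartC

noncomputable section PartD

lemma gauss_dom (a c t : ℝ) (ha : 0 < a) :
    exp (-a * t^2 + c * t) ≤ exp (c^2 / (2*a)) * exp (-(a/2) * t^2) := by
  rw [← exp_add, exp_le_exp]
  have h : 0 ≤ (a * t - c)^2 / (2 * a) := by positivity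
  have e : (a * t - c)^2 / (2 * a) = a / 2 * t^2 - c * t + c^2 / (2 * a) := by field_simp; ring
  linarith

lemma one_add_pow_le (m : ℕ) (r : ℝ) (hr : 0 ≤ r) : (1 + r)^m ≤ m.factorial * exp (1 + r) := by
  have := Real.pow_div_factorial_le_exp (1 + r) (by linarith) m
  rw [div_le_iff₀ (by positivity)] at this
  linarith

lemma poly_gauss_le (m : ℕ) (a c : ℝ) (ha : 0 < a) : ∃ C > 0, ∀ r, 0 ≤ r →
    (1 + r)^m * exp (c * r - a * r^2) ≤ C * exp (-(a/2) * r^2) := by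
  refine ⟨m.factorial * (exp 1 * exp ((c+1)^2/(2*a))), by positivity, fun r hr => ?_⟩
  calc (1 + r)^m * exp (c * r - a * r^2) ≤ (m.factorial * exp (1 + r)) * exp (c * r - a * r^2) := by
        gcongr; exact one_add_pow_le m r hr
    _ = m.factorial * (exp 1 * exp (-a * r^2 + (c+1) * r)) := by
        rw [mul_assoc, ← exp_add, ← exp_add]; ring_nf
    _ ≤ m.factorial * (exp 1 * (exp ((c+1)^2/(2*a)) * exp (-(a/2) * r^2))) := by
        gcongr; exact gauss_dom a (c+1) r ha
    _ = _ := by ring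

lemma intOn_of_dom (F D : ℝ → ℝ) (hF : ContinuousOn F (Set.Ioi 0)) (m : ℕ) (M a c : ℝ) (ha : 0 < a)
    (hD : ∀ r, 0 ≤ r → D r ≤ exp (c * r - a * r^2)) (hM : 0 ≤ M)
    (hb : ∀ r, 0 < r → |F r| ≤ M * (1 + r)^m * D r) : IntegrableOn F (Set.Ioi 0) := by
  obtain ⟨C, hC, h⟩ := poly_gauss_le m a c ha
  have hi : IntegrableOn (fun r => M * (C * exp (-(a/2) * r^2))) (Set.Ioi 0) :=
    (((integrable_exp_neg_mul_sq (by positivity : 0 < a/2)).const_mul C).const_mul M).integrableOn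
  refine Integrable.mono' hi (hF.aestronglyMeasurable measurableSet_Ioi) ?_
  filter_upwards [ae_restrict_mem measurableSet_Ioi] with r hr
  have hr' : 0 < r := hr
  calc ‖F r‖ ≤ M * (1 + r)^m * D r := hb r hr
    _ ≤ M * (1 + r)^m * exp (c * r - a * r^2) := by gcongr; exact hD r hr'.le
    _ = M * ((1 + r)^m * exp (c * r - a * r^2)) := by ring
    _ ≤ _ := mul_le_mul_of_nonneg_left (h r hr'.le) hM

lemma laplace1d (N k : ℕ) (hNk : N = 2 + k) (n : ℕ) (hn : 1 ≤ n) (b c : ℝ) (hc : 0 < c)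
    (hcoer : ∀ r, 0 ≤ r → c * (r^2-b^2)^2 ≤ (Kf N b - Kf N r) * (r^2-b^2) * (1 + r^2))
    (D : ℝ → ℝ) (hDc : Continuous D) (hDpos : ∀ r, 0 < D r)
    (hDd : ∀ r, 0 < r → HasDerivAt D (-(n * r * (Kf N b - Kf N r)) * D r) r)
    (a e : ℝ) (ha : 0 < a) (hDb : ∀ r, 0 ≤ r → D r ≤ exp (e * r - a * r^2)) :
    ∫ r in Set.Ioi (0:ℝ), r^(k+1) * ((r^2-b^2)^2 * D r) ≤
      (2 * ((k+4) * (1 + b^2) + (k+4)^2 / (2*c)) / c / n) * ∫ r in Set.Ioi (0:ℝ), r^(k+1) * D r := by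
  have hN : 2 ≤ N := by omega
  have hn' : (1:ℝ) ≤ n := by exact_mod_cast hn
  have hKc := Kf_continuous N hN
  set C0 := ((k:ℝ)+4) * (1 + b^2) + (k+4)^2 / (2*c) with hC0
  let G : ℝ → ℝ := fun r => r^k * ((r^2-b^2) * (1+r^2)) * D r
  let G' : ℝ → ℝ := fun r => (k * r^(k-1) * ((r^2-b^2)*(1+r^2)) + r^k * (2*r*(1+r^2) + (r^2-b^2)*(2*r))
    - n * r^(k+1) * ((Kf N b - Kf N r) * ((r^2-b^2)*(1+r^2)))) * D r
  have hG : ∀ r, 0 < r → HasDerivAt G (G' r) r := by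
    intro r hr
    have h1 := ((hasDerivAt_pow k r).mul (((hasDerivAt_pow 2 r).sub_const (b^2)).mul ((hasDerivAt_pow 2 r).const_add 1))).mul (hDd r hr)
    refine h1.congr_deriv ?_
    simp only [G', Pi.mul_apply]
    rw [pow_succ r k]
    push_cast
    ring
  have hpow : ∀ (m p : ℕ) (r : ℝ), 0 ≤ r → m ≤ p → r^m ≤ (1+r)^p := by
    intro m p r hr h
    calc r^m ≤ (1+r)^m := by gcongr; linarith
      _ ≤ (1+r)^p := pow_le_pow_right₀ (by linarith) h
  have hq : ∀ r, 0 ≤ r → |r^2-b^2| ≤ (1+b^2) * (1+r)^2 := by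
    intro r hr
    rw [abs_le]; constructor <;> nlinarith [sq_nonneg r, sq_nonneg b, mul_nonneg (sq_nonneg r) (sq_nonneg b), mul_nonneg hr (sq_nonneg b)]
  have hq1 : ∀ r : ℝ, 0 ≤ r → 1 + r^2 ≤ (1+r)^2 := fun r hr => by nlinarith
  have hi1 : IntegrableOn (fun r => r^(k+1) * D r) (Set.Ioi 0) := by
    refine intOn_of_dom _ D (by fun_prop) (k+1) 1 a e ha hDb zero_le_one fun r hr => ?_
    have := hDpos r
    rw [abs_of_pos (by positivity), one_mul]
    gcongr; linarith
  have hi2 : IntegrableOn (fun r => r^(k+1) * ((r^2-b^2)^2 * D r)) (Set.Ioi 0) := by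
    refine intOn_of_dom _ D (by fun_prop) (k+1+4) ((1+b^2)^2) a e ha hDb (by positivity) fun r hr => ?_
    have := hDpos r
    have h2 := hq r hr.le
    rw [abs_of_nonneg (by positivity)]
    have h3 : (r^2-b^2)^2 ≤ ((1+b^2) * (1+r)^2)^2 := by rw [← sq_abs]; gcongr
    calc r^(k+1) * ((r^2-b^2)^2 * D r) ≤ (1+r)^(k+1) * (((1+b^2) * (1+r)^2)^2 * D r) := by
          gcongr; linarith
      _ = _ := by ring
  have hiG : IntegrableOn G (Set.Ioi 0) := by
    refine intOn_of_dom _ D (by fun_prop) (k+4) (1+b^2) a e ha hDb (by positivity) fun r hr => ?_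
    have := hDpos r
    have h2 := hq r hr.le
    have h3 := hq1 r hr.le
    simp only [G]
    rw [abs_mul, abs_mul, abs_mul, abs_of_pos this, abs_of_pos (by positivity : 0 < r^k), abs_of_pos (by positivity : 0 < 1 + r^2)]
    calc r^k * (|r^2-b^2| * (1+r^2)) * D r ≤ (1+r)^k * (((1+b^2) * (1+r)^2) * (1+r)^2) * D r := by
          gcongr; linarith
      _ = _ := by ring
  have hiG' : IntegrableOn G' (Set.Ioi 0) := by
    refine intOn_of_dom _ D (by fun_prop) (k+5) ((k + 4 + 2 * n) * (1+b^2)) a e ha hDb (by positivity) fun r hr => ?_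
    have := hDpos r
    have h2 := hq r hr.le
    have h3 := hq1 r hr.le
    have h4 : |Kf N b - Kf N r| ≤ 2 := by
      have := Kf_pos N hN b; have := Kf_pos N hN r
      have := Kf_le_one N hN b; have := Kf_le_one N hN r
      rw [abs_le]; constructor <;> linarith
    have h5 : |(r^2-b^2)*(1+r^2)| ≤ (1+b^2) * (1+r)^4 := by
      rw [abs_mul, abs_of_pos (by positivity : 0 < 1 + r^2)]
      calc _ ≤ (1+b^2) * (1+r)^2 * (1+r)^2 := by gcongr
        _ = _ := by ring
    have b1 : 1 ≤ 1 + b^2 := by nlinarith [sq_nonneg b]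
    have r1 : 1 ≤ 1 + r := by linarith
    simp only [G']
    rw [abs_mul, abs_of_pos this]
    refine mul_le_mul_of_nonneg_right ?_ this.le
    have t1 : |k * r^(k-1) * ((r^2-b^2)*(1+r^2))| ≤ k * (1+b^2) * (1+r)^(k+5) := by
      rw [abs_mul, abs_of_nonneg (by positivity : 0 ≤ (k:ℝ) * r^(k-1))]
      calc k * r^(k-1) * |(r^2-b^2)*(1+r^2)| ≤ k * (1+r)^(k+1) * ((1+b^2) * (1+r)^4) := by
            gcongr; exact hpow _ _ r hr.le (by omega)
        _ = _ := by ring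
    have t2 : |r^k * (2*r*(1+r^2) + (r^2-b^2)*(2*r))| ≤ 4 * (1+b^2) * (1+r)^(k+5) := by
      have : |2*r*(1+r^2) + (r^2-b^2)*(2*r)| ≤ 4 * (1+b^2) * (1+r)^3 := by
        calc |2*r*(1+r^2) + (r^2-b^2)*(2*r)| ≤ |2*r*(1+r^2)| + |(r^2-b^2)*(2*r)| := abs_add_le _ _
          _ = 2 * r * (1+r^2) + |r^2-b^2| * (2 * r) := by
            rw [abs_mul (r^2-b^2), abs_of_pos (by positivity : 0 < 2 * r * (1+r^2)), abs_of_pos (by positivity : 0 < 2 * r)]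
          _ ≤ 2 * (1+r) * ((1+b^2) * (1+r)^2) + ((1+b^2) * (1+r)^2) * (2 * (1+r)) := by
            gcongr
            · linarith
            · exact h3.trans (le_mul_of_one_le_left (by positivity) b1)
            · linarith
          _ = _ := by ring
      rw [abs_mul, abs_of_pos (by positivity : 0 < r^k)]
      calc _ ≤ (1+r)^(k+2) * (4 * (1+b^2) * (1+r)^3) := by gcongr; exact hpow _ _ r hr.le (by omega)
        _ = _ := by ring
    have t3 : |n * r^(k+1) * ((Kf N b - Kf N r) * ((r^2-b^2)*(1+r^2)))| ≤ 2 * n * (1+b^2) * (1+r)^(k+5) := by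
      rw [abs_mul, abs_of_nonneg (by positivity : 0 ≤ (n:ℝ) * r^(k+1)), abs_mul]
      calc _ ≤ n * (1+r)^(k+1) * (2 * ((1+b^2) * (1+r)^4)) := by gcongr; linarith
        _ = _ := by ring
    refine (abs_sub _ _).trans ((add_le_add ((abs_add_le _ _).trans (add_le_add t1 t2)) t3).trans (le_of_eq ?_))
    ring
  have hlim := tendsto_zero_of_hasDerivAt_of_integrableOn_Ioi (a := 0) (f := G) (f' := G') (fun r hr => hG r hr) hiG' hiG
  have hGc : Continuous G := by fun_prop
  have hIntg := integral_Ioi_of_hasDerivAt_of_tendsto (a := 0) (f := G) (f' := G') hGc.continuousWithinAt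
    (fun r hr => hG r hr) hiG' hlim
  have hG0 : G 0 ≤ 0 := by
    have h1 := hDpos 0
    have h2 : (0:ℝ) ≤ 0^k := by positivity
    have h3 := mul_nonneg (mul_nonneg h2 h1.le) (sq_nonneg b)
    simp only [G]
    nlinarith
  have hle : ∫ r in Set.Ioi (0:ℝ), G' r ≤ ∫ r in Set.Ioi (0:ℝ), (C0 * (r^(k+1) * D r) - n * c / 2 * (r^(k+1) * ((r^2-b^2)^2 * D r))) := by
    refine setIntegral_mono_on hiG' ((hi1.const_mul _).sub (hi2.const_mul _)) measurableSet_Ioi fun r hr => ?_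
    have hr' : 0 < r := hr
    have hD := hDpos r
    have h1 := hcoer r hr'.le
    simp only [G']
    have k1 : k * r^(k-1) * ((r^2-b^2)*(1+r^2)) ≤ k * r^(k+1) * (1+r^2) := by
      rcases Nat.eq_zero_or_pos k with h | h
      · subst h; simp
      · obtain ⟨j, rfl⟩ := Nat.exists_eq_add_of_le h
        have e1 : 1 + j - 1 = j := by omega
        rw [e1]
        have e2 : r^(1+j+1) = r^j * r^2 := by ring
        rw [e2]
        have : (r^2-b^2)*(1+r^2) ≤ r^2 * (1 + r^2) := by gcongr; nlinarith [sq_nonneg b]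
        calc _ ≤ ((1+j:ℕ):ℝ) * r^j * (r^2 * (1 + r^2)) := by gcongr
          _ = _ := by ring
    have k2 : r^k * (2*r*(1+r^2) + (r^2-b^2)*(2*r)) ≤ r^(k+1) * (4 * (1+r^2)) := by
      rw [show r^(k+1)*(4*(1+r^2)) = r^k*(r*(4*(1+r^2))) by ring]
      have : 2*r*(1+r^2) + (r^2-b^2)*(2*r) ≤ r * (4 * (1+r^2)) := by nlinarith [sq_nonneg b, mul_nonneg hr'.le (sq_nonneg b)]
      exact mul_le_mul_of_nonneg_left this (by positivity)
    have k3 : n * r^(k+1) * (c * (r^2-b^2)^2) ≤ n * r^(k+1) * ((Kf N b - Kf N r) * ((r^2-b^2)*(1+r^2))) := by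
      rw [← mul_assoc (Kf N b - Kf N r)]; gcongr
    have k4 : ((k:ℝ)+4) * (1+r^2) ≤ C0 + c / 2 * (r^2-b^2)^2 := by
      have h : 0 ≤ (c * (r^2-b^2) - (k+4))^2 / (2*c) := by positivity
      have e : (c * (r^2-b^2) - (k+4))^2 / (2*c) = c/2 * (r^2-b^2)^2 - (k+4)*(r^2-b^2) + (k+4)^2/(2*c) := by
        field_simp; ring
      rw [hC0]
      linarith
    have k5 : r^(k+1) * (((k:ℝ)+4) * (1+r^2)) ≤ r^(k+1) * (C0 + n * c / 2 * (r^2-b^2)^2) := by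
      gcongr
      refine k4.trans ?_
      gcongr
      nlinarith
    have : (k * r^(k-1) * ((r^2-b^2)*(1+r^2)) + r^k * (2*r*(1+r^2) + (r^2-b^2)*(2*r))
    - n * r^(k+1) * ((Kf N b - Kf N r) * ((r^2-b^2)*(1+r^2)))) ≤ r^(k+1) * (C0 - n * c / 2 * (r^2-b^2)^2) := by
      linarith
    calc _ ≤ r^(k+1) * (C0 - n * c / 2 * (r^2-b^2)^2) * D r := by gcongr
      _ = _ := by ring
  rw [integral_sub (hi1.const_mul _) (hi2.const_mul _), integral_const_mul, integral_const_mul, hIntg] at hle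
  have hfin : n * c / 2 * ∫ r in Set.Ioi (0:ℝ), r^(k+1) * ((r^2-b^2)^2 * D r) ≤ C0 * ∫ r in Set.Ioi (0:ℝ), r^(k+1) * D r := by
    linarith
  have hnc : 0 < n * c / 2 := by positivity
  have hn0 : (n:ℝ) ≠ 0 := by positivity
  rw [show 2*C0/c/n = C0/(n*c/2) by field_simp, div_mul_eq_mul_div, le_div_iff₀' hnc]
  exact hfin

end PartD

noncomputable section PartF

/-- exponential weight -/
def ew (x s : ℝ) : ℝ := exp (-s^2/2 - x*s)

lemma ew_cont (x : ℝ) : Continuous (ew x) := by unfold ew; fun_prop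

lemma ew_pos (x s : ℝ) : 0 < ew x s := exp_pos _

lemma ew_int (x : ℝ) (m : ℕ) (hx : 0 ≤ x) : IntegrableOn (fun s => s^m * ew x s) (Set.Ioi 0) := by
  have h := (integrable_rpow_mul_exp_neg_mul_sq (b := 1/2) (by norm_num) (s := m) (neg_one_lt_zero.trans_le (Nat.cast_nonneg m))).integrableOn (s := Set.Ioi (0:ℝ))
  refine Integrable.mono' h (by have := ew_cont x; exact Continuous.aestronglyMeasurable (by fun_prop)) ?_
  filter_upwards [ae_restrict_mem measurableSet_Ioi] with s hs
  have hs' : 0 < s := hs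
  rw [Real.norm_of_nonneg (by have := ew_pos x s; positivity), rpow_natCast]
  unfold ew
  gcongr
  nlinarith [mul_nonneg hx hs'.le]

def MM (x : ℝ) (m : ℕ) : ℝ := ∫ s in Set.Ioi (0:ℝ), s^m * ew x s

lemma MM_nonneg (x : ℝ) (m : ℕ) : 0 ≤ MM x m :=
  setIntegral_nonneg measurableSet_Ioi fun s hs => by
    have hs' : 0 < s := hs
    have := ew_pos x s; positivity

lemma ew_deriv (x s : ℝ) : HasDerivAt (ew x) (-(s + x) * ew x s) s := by
  unfold ew
  have h : HasDerivAt (fun s : ℝ => -s^2/2 - x*s) (-(s+x)) s := by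
    have := (((hasDerivAt_pow 2 s).neg).div_const 2).sub ((hasDerivAt_id s).const_mul x)
    refine this.congr_deriv ?_
    simp; ring
  refine h.exp.congr_deriv ?_
  ring

lemma MM_rel1 (x : ℝ) (hx : 0 ≤ x) : MM x 1 = 1 - x * MM x 0 := by
  have hi0 := ew_int x 0 hx
  have hi1 := ew_int x 1 hx
  have hI : IntegrableOn (fun s => -(s + x) * ew x s) (Set.Ioi 0) := by
    refine ((hi1.add (hi0.const_mul x)).neg).congr (Filter.Eventually.of_forall fun s => ?_)
    simp; ring
  have hE : IntegrableOn (ew x) (Set.Ioi 0) := by simpa using hi0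
  have hlim := tendsto_zero_of_hasDerivAt_of_integrableOn_Ioi (a := 0) (fun s _ => ew_deriv x s) hI hE
  have hIntg := integral_Ioi_of_hasDerivAt_of_tendsto (a := 0) (ew_cont x).continuousWithinAt
    (fun s _ => ew_deriv x s) hI hlim
  have e : ∫ s in Set.Ioi (0:ℝ), -(s + x) * ew x s = -(MM x 1 + x * MM x 0) := by
    unfold MM
    rw [← integral_const_mul, ← integral_add hi1 (hi0.const_mul x), ← integral_neg]
    congr 1; ext s; simp; ring
  rw [e] at hIntg
  have : ew x 0 = 1 := by simp [ew]
  rw [this] at hIntg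
  linarith

lemma MM_rel2 (x : ℝ) (hx : 0 ≤ x) : MM x 2 = MM x 0 - x * MM x 1 := by
  have hi0 := ew_int x 0 hx
  have hi1 := ew_int x 1 hx
  have hi2 := ew_int x 2 hx
  have hd : ∀ s, HasDerivAt (fun s => s * ew x s) (ew x s - s * (s + x) * ew x s) s := by
    intro s
    refine ((hasDerivAt_id s).mul (ew_deriv x s)).congr_deriv ?_
    simp; ring
  have hI : IntegrableOn (fun s => ew x s - s * (s + x) * ew x s) (Set.Ioi 0) := by
    refine (hi0.sub (hi2.add (hi1.const_mul x))).congr (Filter.Eventually.of_forall fun s => ?_)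
    simp; ring
  have hE : IntegrableOn (fun s => s * ew x s) (Set.Ioi 0) := by simpa using hi1
  have hlim := tendsto_zero_of_hasDerivAt_of_integrableOn_Ioi (a := 0) (fun s _ => hd s) hI hE
  have hIntg := integral_Ioi_of_hasDerivAt_of_tendsto (a := 0)
    (hd 0).continuousAt.continuousWithinAt
    (fun s _ => hd s) hI hlim
  have e : ∫ s in Set.Ioi (0:ℝ), (ew x s - s * (s + x) * ew x s) = MM x 0 - (MM x 2 + x * MM x 1) := by
    unfold MM
    rw [← integral_const_mul, ← integral_add hi2 (hi1.const_mul x), ← integral_sub hi0]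
    · congr 1; ext s; simp; ring
    · exact hi2.add (hi1.const_mul x)
  rw [e] at hIntg
  simp at hIntg
  linarith

lemma MM_anti (x : ℝ) (hx : 0 ≤ x) : MM x 0 ≤ MM 0 0 := by
  refine setIntegral_mono_on (ew_int x 0 hx) (ew_int 0 0 le_rfl) measurableSet_Ioi fun s hs => ?_
  have hs' : 0 < s := hs
  unfold ew
  gcongr

/-- the tail function -/
def TT (k : ℝ → ℝ) (x : ℝ) : ℝ := ∫ s in Set.Ioi (0:ℝ), k (x + s) * ew x s

lemma TT_bounds (k : ℝ → ℝ) (hk : ∀ x y, |k x - k y| ≤ |x - y|) (hk0 : |k 0| ≤ 1) (x : ℝ) (hx : 0 ≤ x) :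
    |TT k x| ≤ 4 + MM 0 0 ∧ |k x - x * TT k x| ≤ 4 + MM 0 0 ∧ |(1 + x^2) * TT k x - x * k x| ≤ 3 + MM 0 0 := by
  have hkc : Continuous k := by
    have : LipschitzWith 1 k := LipschitzWith.of_dist_le_mul fun a c => by
      simpa [Real.dist_eq] using hk a c
    exact this.continuous
  have hi0 := ew_int x 0 hx
  have hi1 := ew_int x 1 hx
  have hic : IntegrableOn (fun s => (k (x+s) - k x) * ew x s) (Set.Ioi 0) := by
    refine Integrable.mono' hi1 (by have := ew_cont x; exact Continuous.aestronglyMeasurable (by fun_prop)) ?_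
    filter_upwards [ae_restrict_mem measurableSet_Ioi] with s hs
    have hs' : 0 < s := hs
    rw [norm_mul, Real.norm_of_nonneg (ew_pos x s).le, pow_one]
    have h := hk (x+s) x
    rw [add_sub_cancel_left, abs_of_pos hs'] at h
    exact mul_le_mul_of_nonneg_right h (ew_pos x s).le
  set M := MM x 0 with hM
  set Q := MM x 1 with hQ
  set R := MM x 2 with hR
  obtain ⟨δ, hδ⟩ : ∃ δ, δ = ∫ s in Set.Ioi (0:ℝ), (k (x+s) - k x) * ew x s := ⟨_, rfl⟩
  have hT : TT k x = k x * M + δ := by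
    rw [hδ, hM]; unfold TT MM
    rw [← integral_const_mul, ← integral_add (hi0.const_mul _) hic]
    congr 1; ext s; simp; ring
  have hδQ : |δ| ≤ Q := by
    rw [hδ, hQ]; unfold MM
    refine (abs_integral_le_integral_abs).trans (setIntegral_mono_on hic.abs hi1 measurableSet_Ioi fun s hs => ?_)
    have hs' : 0 < s := hs
    rw [abs_mul, abs_of_pos (ew_pos x s), pow_one]
    have h := hk (x+s) x
    rw [add_sub_cancel_left, abs_of_pos hs'] at h
    exact mul_le_mul_of_nonneg_right h (ew_pos x s).le
  have r1 : Q = 1 - x * M := MM_rel1 x hx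
  have r2 : R = M - x * Q := MM_rel2 x hx
  have M0 : 0 ≤ M := MM_nonneg x 0
  have Q0 : 0 ≤ Q := MM_nonneg x 1
  have R0 : 0 ≤ R := MM_nonneg x 2
  have Ma : M ≤ MM 0 0 := MM_anti x hx
  have hkx : |k x| ≤ x + 1 := by
    have := hk x 0
    rw [sub_zero, abs_of_nonneg hx] at this
    have h3 := abs_add_le (k x - k 0) (k 0)
    rw [sub_add_cancel] at h3
    linarith
  have xM : x * M ≤ 1 := by linarith
  have hR' : R = (1 + x^2) * M - x := by rw [r2, r1]; ring
  have Q1 : (1 + x^2) * Q ≤ 1 := by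
    have : (1 + x^2) * Q = 1 - x * R := by rw [hR', r1]; ring
    rw [this]; nlinarith [mul_nonneg hx R0]
  have xR : x * R ≤ 1 := by
    have : (1 + x^2) * Q = 1 - x * R := by rw [hR', r1]; ring
    nlinarith [mul_nonneg (by positivity : 0 ≤ 1 + x^2) Q0]
  have RM : R ≤ M := by nlinarith [mul_nonneg hx Q0]
  have Q2 : Q ≤ 1 := by nlinarith [mul_nonneg (sq_nonneg x) Q0]
  have xQ : x * Q ≤ 1 := by nlinarith [mul_nonneg (sq_nonneg (x-1)) Q0]
  refine ⟨?_, ?_, ?_⟩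
  · rw [hT]
    calc |k x * M + δ| ≤ |k x| * M + |δ| := by
          refine (abs_add_le _ _).trans ?_
          rw [abs_mul, abs_of_nonneg M0]
      _ ≤ (x + 1) * M + Q := by gcongr
      _ ≤ _ := by linarith
  · have : k x - x * TT k x = k x * Q - x * δ := by rw [hT, r1]; ring
    rw [this]
    calc |k x * Q - x * δ| ≤ |k x| * Q + x * |δ| := by
          refine (abs_sub _ _).trans ?_
          rw [abs_mul, abs_mul, abs_of_nonneg Q0, abs_of_nonneg hx]
      _ ≤ (x + 1) * Q + x * Q := by gcongr
      _ ≤ _ := by linarith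
  · have : (1 + x^2) * TT k x - x * k x = k x * R + (1 + x^2) * δ := by rw [hT, hR']; ring
    rw [this]
    calc |k x * R + (1 + x^2) * δ| ≤ |k x| * R + (1 + x^2) * |δ| := by
          refine (abs_add_le _ _).trans ?_
          rw [abs_mul, abs_mul, abs_of_nonneg R0, abs_of_nonneg (by positivity : 0 ≤ 1 + x^2)]
      _ ≤ (x + 1) * R + (1 + x^2) * Q := by gcongr
      _ ≤ _ := by linarith

lemma TT_eq (k : ℝ → ℝ) (x : ℝ) : TT k x = exp (x^2/2) * ∫ t in Set.Ioi x, k t * exp (-t^2/2) := by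
  have h := (measurePreserving_add_left volume x).setIntegral_preimage_emb (measurableEmbedding_addLeft x)
    (fun t => k t * exp (-t^2/2)) (Set.Ioi x)
  have hs : (fun t => x + t) ⁻¹' Set.Ioi x = Set.Ioi (0:ℝ) := by ext t; simp
  rw [hs] at h
  rw [← h, ← integral_const_mul]
  unfold TT ew
  congr 1; ext s
  rw [mul_left_comm, ← exp_add]
  congr 2
  ring

lemma lip_gauss_int (k : ℝ → ℝ) (hk : ∀ x y, |k x - k y| ≤ |x - y|) :
    Integrable (fun t => k t * exp (-t^2/2)) := by
  have hkc : Continuous k := by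
    have : LipschitzWith 1 k := LipschitzWith.of_dist_le_mul fun a c => by
      simpa [Real.dist_eq] using hk a c
    exact this.continuous
  have h1 := integrable_mul_exp_neg_mul_sq (b := 1/2) (by norm_num)
  have h0 := integrable_exp_neg_mul_sq (b := 1/2) (by norm_num)
  refine Integrable.mono' (h1.abs.add (h0.const_mul |k 0|)) (by fun_prop) (Filter.Eventually.of_forall fun t => ?_)
  have h := hk t 0
  rw [sub_zero] at h
  have h3 := abs_add_le (k t - k 0) (k 0)
  rw [sub_add_cancel] at h3
  rw [show -t^2/2 = -(1/2) * t^2 by ring]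
  simp only [norm_mul, Real.norm_eq_abs, Pi.add_apply, abs_mul, abs_exp]
  rw [← add_mul]
  gcongr
  linarith

theorem stein_sol : ∃ c > 0, ∀ h : ℝ → ℝ, Differentiable ℝ h → (∀ x, |deriv h x| ≤ 1) →
    ∃ g g' : ℝ → ℝ, (∀ x, HasDerivAt g (g' x) x) ∧
      (∀ x, g' x - x * g x = h x - ∫ x, h x ∂(ProbabilityTheory.gaussianReal 0 1)) ∧
      (∀ x, |g x| ≤ c) ∧ (∀ x, |g' x| ≤ c) ∧ (∀ x y, |g' x - g' y| ≤ c * |x - y|) := by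
  have M0 := MM_nonneg 0 0
  refine ⟨4 + MM 0 0, by linarith, fun h hd hb => ?_⟩
  have hlip : ∀ x y, |h x - h y| ≤ |x - y| := by
    intro x y
    have := Convex.norm_image_sub_le_of_norm_deriv_le (f := h) (s := Set.univ) (C := 1) (x := y) (y := x)
      (fun x _ => hd x) (fun x _ => hb x) convex_univ (Set.mem_univ _) (Set.mem_univ _)
    simpa using this
  set m := ∫ x, h x ∂(ProbabilityTheory.gaussianReal 0 1) with hm
  have hid : MemLp id 2 (ProbabilityTheory.gaussianReal 0 1) := ProbabilityTheory.memLp_id_gaussianReal 2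
  have hidi : Integrable (fun x : ℝ => x) (ProbabilityTheory.gaussianReal 0 1) := hid.integrable (by norm_num)
  have hsq : Integrable (fun x : ℝ => x^2) (ProbabilityTheory.gaussianReal 0 1) := hid.integrable_sq
  have hsq1 : ∫ x, x^2 ∂(ProbabilityTheory.gaussianReal 0 1) = 1 := by
    have := ProbabilityTheory.variance_fun_id_gaussianReal (μ := 0) (v := 1)
    rw [ProbabilityTheory.variance_eq_integral (by fun_prop)] at this
    simpa using this
  have hhi : Integrable h (ProbabilityTheory.gaussianReal 0 1) := by
    refine Integrable.mono' (hidi.abs.add (integrable_const |h 0|)) hd.continuous.aestronglyMeasurable (Filter.Eventually.of_forall fun t => ?_)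
    have h1 := hlip t 0
    rw [sub_zero] at h1
    have h3 := abs_add_le (h t - h 0) (h 0)
    rw [sub_add_cancel] at h3
    simp only [Pi.add_apply, Real.norm_eq_abs]
    linarith
  have hm0 : |h 0 - m| ≤ 1 := by
    have e : h 0 - m = ∫ x, (h 0 - h x) ∂(ProbabilityTheory.gaussianReal 0 1) := by
      rw [integral_sub (integrable_const _) hhi]; simp [hm]
    rw [e]
    refine (abs_integral_le_integral_abs).trans ?_
    calc ∫ x, |h 0 - h x| ∂(ProbabilityTheory.gaussianReal 0 1) ≤ ∫ x, (1/2 + 1/2 * x^2) ∂(ProbabilityTheory.gaussianReal 0 1) := by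
          refine integral_mono ((integrable_const _).sub hhi).abs ((integrable_const _).add (hsq.const_mul _)) fun x => ?_
          have h1 := hlip 0 x
          rw [zero_sub, abs_neg] at h1
          simp only
          nlinarith [sq_abs x, sq_nonneg (|x| - 1)]
      _ = 1 := by
          rw [integral_add (integrable_const _) (hsq.const_mul _), integral_const_mul, hsq1]; norm_num
  set k : ℝ → ℝ := fun x => h x - m with hk
  have hklip : ∀ x y, |k x - k y| ≤ |x - y| := fun x y => by simpa [hk] using hlip x y
  have hkc : Continuous k := by have := hd.continuous; fun_prop
  have hki := lip_gauss_int k hklip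
  have hk0 : ∫ t, k t * exp (-t^2/2) = 0 := by
    have h1 : ∫ t, k t ∂(ProbabilityTheory.gaussianReal 0 1) = 0 := by
      simp only [hk]
      rw [integral_sub hhi (integrable_const _)]; simp [hm]
    rw [ProbabilityTheory.integral_gaussianReal_eq_integral_smul (by norm_num)] at h1
    have e : ∀ x, ProbabilityTheory.gaussianPDFReal 0 1 x • k x = (√(2 * π))⁻¹ * (k x * exp (-x^2/2)) := by
      intro x
      simp [ProbabilityTheory.gaussianPDFReal]; ring
    simp_rw [e] at h1
    rw [integral_const_mul] at h1
    have : (√(2 * π))⁻¹ ≠ 0 := by positivity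
    exact (mul_eq_zero.mp h1).resolve_left this
  set g : ℝ → ℝ := fun x => exp (x^2/2) * ∫ t in Set.Iic x, k t * exp (-t^2/2) with hg
  set g' : ℝ → ℝ := fun x => x * g x + k x with hg'
  have hsplit : ∀ x, (∫ t in Set.Iic x, k t * exp (-t^2/2)) + ∫ t in Set.Ioi x, k t * exp (-t^2/2) = 0 := by
    intro x
    rw [intervalIntegral.integral_Iic_add_Ioi hki.integrableOn hki.integrableOn, hk0]
  have hder : ∀ x, HasDerivAt g (g' x) x := by
    intro x
    have hI : HasDerivAt (fun x => ∫ t in Set.Iic x, k t * exp (-t^2/2)) (k x * exp (-x^2/2)) x := by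
      have e : (fun x => ∫ t in Set.Iic x, k t * exp (-t^2/2)) = fun x => (∫ t in Set.Iic 0, k t * exp (-t^2/2)) + ∫ t in (0:ℝ)..x, k t * exp (-t^2/2) := by
        ext x
        rw [← intervalIntegral.integral_Iic_sub_Iic hki.integrableOn hki.integrableOn]; ring
      rw [e]
      refine HasDerivAt.const_add _ ?_
      exact intervalIntegral.integral_hasDerivAt_right (hki.intervalIntegrable)
        (Continuous.stronglyMeasurableAtFilter (by fun_prop) _ _) (by fun_prop)
    have hE : HasDerivAt (fun x : ℝ => exp (x^2/2)) (exp (x^2/2) * x) x := by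
      have := ((hasDerivAt_pow 2 x).div_const 2).exp
      refine this.congr_deriv ?_
      simp
    refine (hE.mul hI).congr_deriv ?_
    simp only [hg', hg]
    have : exp (x^2/2) * exp (-x^2/2) = 1 := by rw [← exp_add]; simp; ring
    linear_combination k x * this
  have hder' : ∀ x, HasDerivAt g' ((1 + x^2) * g x + x * k x + deriv h x) x := by
    intro x
    refine (((hasDerivAt_id x).mul (hder x)).add (((hd x).hasDerivAt).sub_const m)).congr_deriv ?_
    simp [hg']; ring
  have hpos : ∀ x, 0 ≤ x → g x = - TT k x := by
    intro x _
    rw [TT_eq]; simp only [hg]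
    linear_combination exp (x^2/2) * hsplit x
  have hneg : ∀ x, g x = TT (fun t => k (-t)) (-x) := by
    intro x
    rw [TT_eq]; simp only [hg]
    have := integral_comp_neg_Ioi (-x) (fun t => k t * exp (-t^2/2))
    rw [neg_neg] at this
    rw [← this]
    simp
  have hall : ∀ x, |g x| ≤ 4 + MM 0 0 ∧ |g' x| ≤ 4 + MM 0 0 ∧ |(1 + x^2) * g x + x * k x| ≤ 3 + MM 0 0 := by
    intro x
    rcases le_total 0 x with hx | hx
    · obtain ⟨a1, a2, a3⟩ := TT_bounds k hklip hm0 x hx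
      simp only [hg']
      rw [hpos x hx]
      refine ⟨by rwa [abs_neg], ?_, ?_⟩
      · convert a2 using 2; ring
      · rw [← abs_neg]; convert a3 using 2; ring
    · obtain ⟨a1, a2, a3⟩ := TT_bounds (fun t => k (-t)) (fun x y => (hklip _ _).trans (by rw [← abs_neg]; apply le_of_eq; congr 1; ring)) (by simpa using hm0) (-x) (by linarith)
      simp only [hg']
      rw [hneg x]
      simp only [neg_neg] at a2 a3
      refine ⟨a1, ?_, ?_⟩
      · convert a2 using 2; ring
      · convert a3 using 2; ring
  refine ⟨g, g', hder, fun x => by simp [hg', hk], fun x => (hall x).1, fun x => (hall x).2.1, fun x y => ?_⟩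
  have := Convex.norm_image_sub_le_of_norm_hasDerivWithin_le (f := g') (s := Set.univ) (C := 4 + MM 0 0) (x := y) (y := x)
      (fun x _ => (hder' x).hasDerivWithinAt) (fun x _ => ?_) convex_univ (Set.mem_univ _) (Set.mem_univ _)
  · simpa using this
  · refine (abs_add_le _ _).trans ?_
    have := hb x; have := (hall x).2.2
    linarith

end PartF

noncomputable section PartE

abbrev EE (N : ℕ) := EuclideanSpace ℝ (Fin N)

abbrev Om (N n : ℕ) := Fin n → UnitSphere N

variable {N n : ℕ}

lemma totalSpin_cont : Continuous (totalSpin : Om N n → EE N) := by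
  unfold totalSpin; fun_prop

lemma totalSpin_norm_le (σ : Om N n) : ‖totalSpin σ‖ ≤ n := by
  unfold totalSpin
  refine (norm_sum_le _ _).trans ?_
  simp

/-- exponent of the joint density -/
def jl (β : ℝ) (p : EE N × Om N n) : ℝ := ⟪p.1, totalSpin p.2⟫ - n / (2 * β) * ‖p.1‖^2

lemma jl_cont (β : ℝ) : Continuous (jl β : EE N × Om N n → ℝ) := by
  unfold jl
  have := totalSpin_cont (N := N) (n := n)
  fun_prop

/-- polynomial growth -/
structure PG (F : EE N × Om N n → ℝ) : Prop where
  cont : Continuous F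
  bd : ∃ C : ℝ, ∃ m : ℕ, 0 ≤ C ∧ ∀ p, |F p| ≤ C * (1 + ‖p.1‖)^m

lemma PG.mul {F G : EE N × Om N n → ℝ} (hF : PG F) (hG : PG G) : PG (fun p => F p * G p) := by
  obtain ⟨C, m, hC, h⟩ := hF.bd
  obtain ⟨C', m', hC', h'⟩ := hG.bd
  refine ⟨hF.cont.mul hG.cont, C * C', m + m', by positivity, fun p => ?_⟩
  rw [abs_mul, pow_add, mul_mul_mul_comm]
  exact mul_le_mul (h p) (h' p) (abs_nonneg _) (by positivity)

lemma PG.add {F G : EE N × Om N n → ℝ} (hF : PG F) (hG : PG G) : PG (fun p => F p + G p) := by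
  obtain ⟨C, m, hC, h⟩ := hF.bd
  obtain ⟨C', m', hC', h'⟩ := hG.bd
  refine ⟨hF.cont.add hG.cont, C + C', m + m', by positivity, fun p => ?_⟩
  have h1 : (1 + ‖p.1‖)^m ≤ (1 + ‖p.1‖)^(m+m') := pow_le_pow_right₀ (by linarith [norm_nonneg p.1]) (by omega)
  have h2 : (1 + ‖p.1‖)^m' ≤ (1 + ‖p.1‖)^(m+m') := pow_le_pow_right₀ (by linarith [norm_nonneg p.1]) (by omega)
  calc |F p + G p| ≤ |F p| + |G p| := abs_add_le _ _
    _ ≤ C * (1 + ‖p.1‖)^m + C' * (1 + ‖p.1‖)^m' := add_le_add (h p) (h' p)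
    _ ≤ C * (1 + ‖p.1‖)^(m+m') + C' * (1 + ‖p.1‖)^(m+m') := by gcongr
    _ = _ := by ring

lemma PG.const (c : ℝ) : PG (fun _ : EE N × Om N n => c) :=
  ⟨continuous_const, |c|, 0, abs_nonneg _, fun p => by simp⟩

lemma PG.neg {F : EE N × Om N n → ℝ} (hF : PG F) : PG (fun p => - F p) := by
  obtain ⟨C, m, hC, h⟩ := hF.bd
  exact ⟨hF.cont.neg, C, m, hC, fun p => by rw [abs_neg]; exact h p⟩

lemma PG.abs {F : EE N × Om N n → ℝ} (hF : PG F) : PG (fun p => |F p|) := by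
  obtain ⟨C, m, hC, h⟩ := hF.bd
  exact ⟨hF.cont.abs, C, m, hC, fun p => by rw [abs_abs]; exact h p⟩

lemma PG.sub {F G : EE N × Om N n → ℝ} (hF : PG F) (hG : PG G) : PG (fun p => F p - G p) := by
  simpa [sub_eq_add_neg] using hF.add hG.neg

lemma PG.pow {F : EE N × Om N n → ℝ} (hF : PG F) (k : ℕ) : PG (fun p => F p ^ k) := by
  induction k with
  | zero => simpa using PG.const 1
  | succ k ih => simpa [pow_succ] using ih.mul hF

lemma PG.sum {ι : Type*} (s : Finset ι) {F : ι → EE N × Om N n → ℝ} (hF : ∀ i, PG (F i)) :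
    PG (fun p => ∑ i ∈ s, F i p) := by
  classical
  induction s using Finset.induction_on with
  | empty => simpa using PG.const 0
  | insert i s hi ih => simpa [Finset.sum_insert hi] using (hF i).add ih

lemma PG.snd {φ : Om N n → ℝ} (hφ : Continuous φ) : PG (fun p : EE N × Om N n => φ p.2) := by
  obtain ⟨C, hC⟩ := (isCompact_univ (X := Om N n)).exists_bound_of_continuousOn hφ.continuousOn
  refine ⟨by fun_prop, max C 0, 0, le_max_right _ _, fun p => ?_⟩
  simpa using Or.inl (hC p.2 (Set.mem_univ _))

lemma PG.norm_fst : PG (fun p : EE N × Om N n => ‖p.1‖) :=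
  ⟨by fun_prop, 1, 1, zero_le_one, fun p => by simp⟩

lemma PG.inner_fst {u : Om N n → EE N} (hu : Continuous u) : PG (fun p : EE N × Om N n => ⟪p.1, u p.2⟫) := by
  obtain ⟨C, hC⟩ := (isCompact_univ (X := Om N n)).exists_bound_of_continuousOn hu.continuousOn
  refine ⟨by fun_prop, max C 0, 1, le_max_right _ _, fun p => ?_⟩
  have h1 := hC p.2 (Set.mem_univ _)
  have h2 := le_max_left C 0
  calc |⟪p.1, u p.2⟫| ≤ ‖p.1‖ * ‖u p.2‖ := abs_real_inner_le_norm _ _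
    _ ≤ (1 + ‖p.1‖) * max C 0 := by
        gcongr
        · linarith
        · linarith
    _ = _ := by ring

lemma PG.bdd_norm {φ : ℝ → ℝ} (hφ : Continuous φ) (C : ℝ) (h : ∀ r, 0 ≤ r → |φ r| ≤ C) :
    PG (fun p : EE N × Om N n => φ ‖p.1‖) :=
  ⟨by fun_prop, C, 0, (abs_nonneg _).trans (h 0 le_rfl), fun p => by simpa using h _ (norm_nonneg p.1)⟩

variable (β : ℝ) (hβ : 0 < β) (hn : 1 ≤ n) (μ : Measure (UnitSphere N)) [IsProbabilityMeasure μ]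

/-- base measure -/
def BM (n : ℕ) : Measure (EE N × Om N n) := (volume : Measure (EE N)).prod (Measure.pi fun _ => μ)

lemma jw_le (p : EE N × Om N n) : exp (jl β p) ≤ exp (n * ‖p.1‖ - n / (2 * β) * ‖p.1‖^2) := by
  unfold jl
  gcongr
  calc ⟪p.1, totalSpin p.2⟫ ≤ ‖p.1‖ * ‖totalSpin p.2‖ := real_inner_le_norm _ _
    _ ≤ ‖p.1‖ * n := by gcongr; exact totalSpin_norm_le _
    _ = _ := by ring

lemma gauss_int (a : ℝ) (ha : 0 < a) : Integrable (fun y : EE N => exp (-a * ‖y‖^2)) := by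
  have h := (GaussianFourier.integrable_cexp_neg_mul_sq_norm_add (V := EE N) (b := (a:ℂ)) (by simpa) 0 0).norm
  refine h.congr (Filter.Eventually.of_forall fun y => ?_)
  simp only [Complex.norm_exp]
  congr 1
  simp [← Complex.ofReal_pow]

include hβ hn in
lemma PG.base_int {F : EE N × Om N n → ℝ} (hF : PG F) : Integrable (fun p => exp (jl β p) * F p) (BM μ n) := by
  obtain ⟨C, m, hC, h⟩ := hF.bd
  have hn' : (0:ℝ) < n := by exact_mod_cast hn
  obtain ⟨C', hC', h'⟩ := poly_gauss_le m (n / (2 * β)) n (by positivity)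
  have hi : Integrable (fun p : EE N × Om N n => (C * (C' * exp (-(n / (2 * β) / 2) * ‖p.1‖^2)))) (BM μ n) :=
    (((gauss_int (N := N) (n / (2 * β) / 2) (by positivity)).comp_fst (Measure.pi fun _ : Fin n => μ)).const_mul C').const_mul C
  refine Integrable.mono' hi ?_ (Filter.Eventually.of_forall fun p => ?_)
  · exact ((jl_cont β).rexp.mul hF.cont).aestronglyMeasurable
  · rw [norm_mul, Real.norm_of_nonneg (exp_pos _).le]
    calc exp (jl β p) * ‖F p‖ ≤ exp (n * ‖p.1‖ - n / (2 * β) * ‖p.1‖^2) * (C * (1 + ‖p.1‖)^m) :=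
          mul_le_mul (jw_le β p) (h p) (norm_nonneg (F p)) (exp_pos _).le
      _ = C * ((1 + ‖p.1‖)^m * exp (n * ‖p.1‖ - n / (2 * β) * ‖p.1‖^2)) := by ring
      _ ≤ _ := mul_le_mul_of_nonneg_left (h' ‖p.1‖ (norm_nonneg p.1)) hC

/-- joint measure -/
def JM (n : ℕ) : Measure (EE N × Om N n) := (BM μ n).tilted (jl β)

include hβ hn in
lemma jw_int : Integrable (fun p => exp (jl β p)) (BM μ n) := by
  simpa using (PG.const (N := N) (n := n) 1).base_int β hβ hn μ

instance : NeZero (BM μ n) := by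
  constructor
  intro h
  have := congrArg (fun m => m Set.univ) h
  simp only [BM, ← Set.univ_prod_univ, Measure.prod_prod] at this
  simp at this
  exact (NeZero.ne (volume : Measure (EE N))) this

include hβ hn in
lemma JM_prob : IsProbabilityMeasure (JM β μ n) := isProbabilityMeasure_tilted (jw_int β hβ hn μ)

include hβ hn in
lemma PG.int {F : EE N × Om N n → ℝ} (hF : PG F) : Integrable F (JM β μ n) := by
  unfold JM
  rw [integrable_tilted_iff (jw_int β hβ hn μ)]
  exact hF.base_int β hβ hn μ

lemma JM_integral (F : EE N × Om N n → ℝ) :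
    ∫ p, F p ∂(JM β μ n) = (∫ p, exp (jl β p) * F p ∂(BM μ n)) / ∫ p, exp (jl β p) ∂(BM μ n) := by
  unfold JM
  rw [integral_tilted, ← integral_div]
  congr 1; ext p
  simp only [smul_eq_mul]; ring

include hβ hn in
lemma jw_int_pos : 0 < ∫ p, exp (jl β p) ∂(BM μ n) := integral_exp_pos (jw_int β hβ hn μ)

lemma gw_eq (σ : Om N n) : gibbsWeight N n β σ = exp (β / (2 * n) * ‖totalSpin σ‖^2) := by
  unfold gibbsWeight totalSpin
  rw [← real_inner_self_eq_norm_sq, sum_inner]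
  simp_rw [inner_sum]

lemma gw_cont : Continuous (gibbsWeight N n β) := by
  have h : gibbsWeight N n β = fun σ => exp (β / (2 * n) * ‖totalSpin σ‖^2) := funext (gw_eq β)
  rw [h]
  have := totalSpin_cont (N := N) (n := n)
  fun_prop

/-- shift vector -/
def sv (σ : Om N n) : EE N := (β / n) • totalSpin σ

lemma sv_cont : Continuous (sv β : Om N n → EE N) := by
  unfold sv
  have := totalSpin_cont (N := N) (n := n)
  fun_prop

include hβ hn in
lemma jl_shift (z : EE N) (σ : Om N n) : exp (jl β (z + sv β σ, σ)) =
    exp (-(n / (2 * β)) * ‖z‖^2) * gibbsWeight N n β σ := by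
  have hn' : (n:ℝ) ≠ 0 := by positivity
  rw [gw_eq, ← exp_add]
  congr 1
  unfold jl sv
  simp only
  rw [norm_add_sq_real, inner_add_left, inner_smul_right, norm_smul, mul_pow, real_inner_smul_left, real_inner_self_eq_norm_sq,
    Real.norm_eq_abs, sq_abs]
  field_simp
  ring

include hβ hn in
lemma shift_formula {F : EE N × Om N n → ℝ} (hF : PG F) :
    ∫ p, exp (jl β p) * F p ∂(BM μ n) =
      ∫ σ, gibbsWeight N n β σ * (∫ z : EE N, exp (-(n / (2 * β)) * ‖z‖^2) * F (z + sv β σ, σ)) ∂(Measure.pi fun _ : Fin n => μ) := by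
  have hi := hF.base_int β hβ hn μ
  unfold BM at hi ⊢
  rw [integral_prod_symm _ hi]
  congr 1; ext σ
  rw [← integral_add_right_eq_self _ (sv β σ), ← integral_const_mul]
  congr 1; ext z
  rw [jl_shift β hβ hn]
  ring

end PartE

noncomputable section PartE2

variable {N n : ℕ}
variable (β : ℝ) (hβ : 0 < β) (hn : 1 ≤ n) (μ : Measure (UnitSphere N)) [IsProbabilityMeasure μ]

include hβ hn in
lemma JM_cond {F : EE N × Om N n → ℝ} (hF : PG F) {c : Om N n → ℝ} (hc : Continuous c)
    (h : ∀ σ, ∫ z : EE N, exp (-(n / (2 * β)) * ‖z‖^2) * F (z + sv β σ, σ) =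
      (∫ z : EE N, exp (-(n / (2 * β)) * ‖z‖^2)) * c σ) :
    ∫ p, F p ∂(JM β μ n) = ∫ p, c p.2 ∂(JM β μ n) := by
  rw [JM_integral, JM_integral, shift_formula β hβ hn μ hF, shift_formula β hβ hn μ (PG.snd hc)]
  congr 2; ext σ
  rw [h]; simp only
  rw [integral_mul_const]

include hβ hn in
lemma JM_snd {φ : Om N n → ℝ} (hφ : Continuous φ) :
    ∫ p, φ p.2 ∂(JM β μ n) = ∫ σ, φ σ ∂(gibbsMeasure N n β μ) := by
  have hn' : (0:ℝ) < n := by exact_mod_cast hn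
  have e1 : ∀ p : EE N × Om N n, exp (jl β p) = exp (jl β p) * 1 := fun p => (mul_one _).symm
  rw [JM_integral, shift_formula β hβ hn μ (PG.snd hφ)]
  have h1 := shift_formula β hβ hn μ (PG.const (N := N) (n := n) 1)
  simp only [mul_one] at h1
  have hpos := jw_int_pos β hβ hn μ (n := n)
  rw [h1] at hpos ⊢
  simp only [integral_mul_const] at hpos ⊢
  have hG : ∀ σ : Om N n, gibbsWeight N n β σ * ((∫ z : EE N, exp (-(n / (2 * β)) * ‖z‖^2)) * φ σ) =
      (gibbsWeight N n β σ * φ σ) * ∫ z : EE N, exp (-(n / (2 * β)) * ‖z‖^2) := fun σ => by ring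
  simp_rw [hG]
  rw [integral_mul_const]
  have hG0 : (∫ z : EE N, exp (-(n / (2 * β)) * ‖z‖^2)) ≠ 0 := fun h => by
    rw [h, mul_zero] at hpos; exact lt_irrefl _ hpos
  rw [mul_div_mul_right _ _ hG0]
  unfold gibbsMeasure
  have hgp : ∀ σ : Om N n, 0 ≤ gibbsWeight N n β σ := fun σ => by rw [gw_eq]; positivity
  have hIntg : 0 ≤ ∫ τ, gibbsWeight N n β τ ∂(Measure.pi fun _ : Fin n => μ) := integral_nonneg hgp
  rw [integral_withDensity_eq_integral_toReal_smul]
  · rw [← integral_div]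
    congr 1; ext σ
    rw [ENNReal.toReal_ofReal (div_nonneg (hgp σ) hIntg)]
    simp only [smul_eq_mul]; ring
  · have := (gw_cont (N := N) (n := n) β).measurable
    fun_prop
  · simp

lemma PG.zinner {u : Om N n → EE N} (hu : Continuous u) : PG (fun p : EE N × Om N n => ⟪p.1 - sv β p.2, u p.2⟫) := by
  have h : (fun p : EE N × Om N n => ⟪p.1 - sv β p.2, u p.2⟫) = fun p => ⟪p.1, u p.2⟫ - ⟪sv β p.2, u p.2⟫ := by
    ext p; rw [inner_sub_left]
  rw [h]
  have := sv_cont (N := N) (n := n) β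
  exact (PG.inner_fst hu).sub (PG.snd (φ := fun σ => ⟪sv β σ, u σ⟫) (by fun_prop))

lemma PG.zsq : PG (fun p : EE N × Om N n => ‖p.1 - sv β p.2‖^2) := by
  have h : (fun p : EE N × Om N n => ‖p.1 - sv β p.2‖^2) = fun p => ‖p.1‖^2 - 2 * ⟪p.1, sv β p.2⟫ + ‖sv β p.2‖^2 := by
    ext p; rw [norm_sub_sq_real]
  rw [h]
  have := sv_cont (N := N) (n := n) β
  exact ((PG.norm_fst.pow 2).sub ((PG.const 2).mul (PG.inner_fst this))).add (PG.snd (φ := fun σ => ‖sv β σ‖^2) (by fun_prop))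

include hβ hn in
lemma JM_odd {u : Om N n → EE N} (hu : Continuous u) : ∫ p, ⟪p.1 - sv β p.2, u p.2⟫ ∂(JM β μ n) = 0 := by
  rw [JM_cond β hβ hn μ (PG.zinner β hu) (c := fun _ => 0) continuous_const]
  · simp
  · intro σ
    simp only [add_sub_cancel_right, mul_zero]
    have h := integral_neg_eq_self (fun z : EE N => exp (-(n / (2 * β)) * ‖z‖^2) * ⟪z, u σ⟫) volume
    simp only [norm_neg, inner_neg_left, mul_neg, integral_neg] at h
    linarith

/-- variance constant -/
def vc (N : ℕ) (β : ℝ) : ℝ := (∫ z : EE N, exp (-(1 / (2 * β)) * ‖z‖^2) * ‖z‖^2) / ∫ z : EE N, exp (-(1 / (2 * β)) * ‖z‖^2)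

lemma vc_nonneg : 0 ≤ vc N β := div_nonneg (integral_nonneg fun z => by positivity) (integral_nonneg fun z => by positivity)

include hβ hn in
lemma vc_eq : ∫ z : EE N, exp (-(n / (2 * β)) * ‖z‖^2) * ‖z‖^2 = (∫ z : EE N, exp (-(n / (2 * β)) * ‖z‖^2)) * (vc N β / n) := by
  have hn' : (0:ℝ) < n := by exact_mod_cast hn
  have hs : √(n:ℝ) ≠ 0 := by positivity
  have hsq : √(n:ℝ)^2 = n := sq_sqrt hn'.le
  have h1 := Measure.integral_comp_smul (volume : Measure (EE N)) (fun z => exp (-(1 / (2 * β)) * ‖z‖^2) * ‖z‖^2) (√n)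
  have h0 := Measure.integral_comp_smul (volume : Measure (EE N)) (fun z => exp (-(1 / (2 * β)) * ‖z‖^2)) (√n)
  have hG : 0 < ∫ z : EE N, exp (-(1 / (2 * β)) * ‖z‖^2) := integral_exp_pos (gauss_int _ (by positivity))
  simp only [norm_smul, mul_pow, Real.norm_eq_abs, sq_abs, hsq, smul_eq_mul] at h1 h0
  have e : ∀ z : EE N, -(n / (2 * β)) * ‖z‖^2 = -(1 / (2 * β)) * (n * ‖z‖^2) := fun z => by ring
  simp_rw [e]
  rw [h0]
  have e2 : ∀ z : EE N, exp (-(1 / (2 * β)) * (n * ‖z‖^2)) * (n * ‖z‖^2) = n * (exp (-(1 / (2 * β)) * (n * ‖z‖^2)) * ‖z‖^2) := fun z => by ring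
  simp_rw [e2] at h1
  rw [integral_const_mul] at h1
  unfold vc
  have hG' := hG.ne'
  generalize (∫ z : EE N, exp (-(1 / (2 * β)) * ‖z‖^2)) = G at hG' ⊢
  rw [show ∀ A X : ℝ, A * G * (X / G / n) = A * X / n from fun A X => by field_simp, ← h1]
  field_simp

include hβ hn in
lemma JM_var {φ : Om N n → ℝ} (hφ : Continuous φ) : ∫ p, ‖p.1 - sv β p.2‖^2 * φ p.2 ∂(JM β μ n) = vc N β / n * ∫ p, φ p.2 ∂(JM β μ n) := by
  rw [JM_cond β hβ hn μ ((PG.zsq β).mul (PG.snd hφ)) (c := fun σ => vc N β / n * φ σ) (by fun_prop), integral_const_mul]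
  intro σ
  simp only [add_sub_cancel_right, ← mul_assoc]
  rw [integral_mul_const, vc_eq β hβ hn]

variable (hμinv : ∀ e : EuclideanSpace ℝ (Fin N) ≃ₗᵢ[ℝ] EuclideanSpace ℝ (Fin N), Measure.map (sphereMap e) μ = μ)

include hμinv in
lemma spin_int (i : Fin N) (y : EE N) : ∫ σ : Om N n, exp ⟪y, totalSpin σ⟫ ∂(Measure.pi fun _ : Fin n => μ) = zr μ i ‖y‖ ^ n := by
  have h : ∀ σ : Om N n, exp ⟪y, totalSpin σ⟫ = ∏ j, exp ⟪y, (σ j : EE N)⟫ := fun σ => by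
    unfold totalSpin; rw [inner_sum, exp_sum]
  simp_rw [h]
  rw [integral_fintype_prod_eq_pow (fun x : UnitSphere N => exp ⟪y, (x : EE N)⟫), sph_Z μ hμinv i y, Fintype.card_fin]

/-- radial density -/
def rD (n : ℕ) (i : Fin N) (r : ℝ) : ℝ := exp (-(n / (2 * β)) * r^2) * zr μ i r ^ n

include hβ hn hμinv in
lemma radial_formula (i : Fin N) (Q : ℝ → ℝ) (hQ : PG (fun p : EE N × Om N n => Q ‖p.1‖)) :
    ∫ p, exp (jl β p) * Q ‖p.1‖ ∂(BM μ n) = (N * volume.real (Metric.ball (0 : EE N) 1)) *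
      ∫ r in Set.Ioi (0:ℝ), r^(N-1) * (Q r * rD β μ n i r) := by
  have hi := hQ.base_int β hβ hn μ
  unfold BM at hi ⊢
  rw [integral_prod _ hi]
  have : ∀ y : EE N, ∫ σ : Om N n, exp (jl β (y, σ)) * Q ‖y‖ ∂(Measure.pi fun _ : Fin n => μ) = Q ‖y‖ * rD β μ n i ‖y‖ := by
    intro y
    rw [integral_mul_const]
    have e : ∀ σ : Om N n, exp (jl β (y, σ)) = exp (-(n / (2 * β)) * ‖y‖^2) * exp ⟪y, totalSpin σ⟫ := fun σ => by
      rw [← exp_add]; unfold jl; congr 1; simp only; ring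
    simp_rw [e]
    rw [integral_const_mul, spin_int μ hμinv i, mul_comm]; rfl
  simp only [this]
  haveI : Nonempty (Fin N) := ⟨i⟩
  haveI : Nontrivial (EE N) := inferInstance
  rw [integral_fun_norm_addHaar volume (fun r => Q r * rD β μ n i r)]
  simp [mul_assoc]

include hβ hμinv in
lemma JM_conc (hN : 2 ≤ N) (b : ℝ) (hb : 0 < b) (hK : Kf N b = 1 / β) :
    ∃ C > 0, ∀ n : ℕ, 1 ≤ n → ∫ p, (‖p.1‖^2 - b^2)^2 ∂(JM β μ n) ≤ C / n := by
  obtain ⟨c, hc, hcoer⟩ := K_coercive N hN b hb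
  obtain ⟨k, rfl⟩ := Nat.exists_eq_add_of_le hN
  let i : Fin (2 + k) := ⟨0, by omega⟩
  refine ⟨2 * ((k+4) * (1 + b^2) + (k+4)^2 / (2*c)) / c, by positivity, fun n hn => ?_⟩
  have hn' : (0:ℝ) < n := by exact_mod_cast hn
  have hzc : Continuous (zr μ i) := continuous_iff_continuousAt.mpr fun r => (zr_hasDerivAt μ i r).continuousAt
  have h1 := laplace1d (2+k) k rfl n hn b c hc hcoer (rD β μ n i) (by unfold rD; fun_prop)
    (fun r => by have := zr_pos μ i r; unfold rD; positivity) (fun r hr => ?_) (n / (2 * β)) n (by positivity) (fun r hr => ?_)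
  · rw [JM_integral, div_le_iff₀ (jw_int_pos β hβ hn μ), radial_formula β hβ hn μ hμinv i (fun r => (r^2-b^2)^2)
      (((PG.norm_fst.pow 2).sub (PG.const _)).pow 2)]
    have h2 := radial_formula β hβ hn μ hμinv i (fun r => 1) (PG.const _)
    simp only [mul_one, one_mul] at h2
    rw [h2]
    have e : 2 + k - 1 = k + 1 := by omega
    rw [e, mul_left_comm]
    refine mul_le_mul_of_nonneg_left h1 (by positivity)
  · have hE : HasDerivAt (fun r : ℝ => exp (-(n / (2 * β)) * r^2)) (exp (-(n / (2 * β)) * r^2) * (-(n / (2 * β)) * (2 * r))) r := by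
      refine (((hasDerivAt_pow 2 r).const_mul _).exp).congr_deriv ?_
      simp
    refine (hE.mul ((zr_hasDerivAt μ i r).pow n)).congr_deriv ?_
    rw [zr_log_deriv hN μ hμinv i r hr, hK]
    unfold rD
    obtain ⟨j, rfl⟩ := Nat.exists_eq_add_of_le hn
    have e : 1 + j - 1 = j := by omega
    rw [e, Pi.pow_apply, pow_add, pow_one]
    field_simp
    ring
  · unfold rD
    have h2 := zr_le μ i r hr
    have h3 := (zr_pos μ i r).le
    calc exp (-(n / (2 * β)) * r^2) * zr μ i r ^ n ≤ exp (-(n / (2 * β)) * r^2) * exp r ^ n := by gcongr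
      _ = _ := by rw [← exp_nat_mul, ← exp_add]; congr 1; ring

lemma resample (i : Fin n) : MeasurePreserving (fun q : Om N n × UnitSphere N => Function.update q.1 i q.2)
    ((Measure.pi fun _ : Fin n => μ).prod μ) (Measure.pi fun _ : Fin n => μ) := by
  have hm : Measurable (fun q : Om N n × UnitSphere N => Function.update q.1 i q.2) := by
    apply Continuous.measurable
    exact continuous_fst.update i continuous_snd
  refine ⟨hm, ?_⟩
  symm
  refine Measure.pi_eq fun s hs => ?_
  rw [Measure.map_apply hm (MeasurableSet.univ_pi hs)]
  have e : (fun q : Om N n × UnitSphere N => Function.update q.1 i q.2) ⁻¹' (Set.univ.pi s) =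
      (Set.univ.pi (Function.update s i Set.univ)) ×ˢ s i := by
    ext q
    simp only [Set.mem_preimage, Set.mem_pi, Set.mem_univ, true_imp_iff, Set.mem_prod]
    constructor
    · intro h
      refine ⟨fun j => ?_, by simpa using h i⟩
      by_cases hj : j = i
      · subst hj; simp
      · simpa [hj] using h j
    · rintro ⟨h1, h2⟩ j
      by_cases hj : j = i
      · subst hj; simpa
      · simpa [hj] using h1 j
  rw [e, Measure.prod_prod, Measure.pi_pi]
  have : ∀ j, μ (Function.update s i Set.univ j) = Function.update (fun j => μ (s j)) i 1 j := by
    intro j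
    by_cases hj : j = i
    · subst hj; simp
    · simp [hj]
  simp_rw [this]
  rw [Finset.prod_update_of_mem (Finset.mem_univ i), one_mul, ← Finset.mul_prod_erase _ _ (Finset.mem_univ i), mul_comm,
    Finset.sdiff_singleton_eq_erase]

/-- leave one out spin -/
def los (i : Fin n) (σ : Om N n) : EE N := totalSpin σ - σ i

lemma los_cont (i : Fin n) : Continuous (los i : Om N n → EE N) := by
  unfold los
  have := totalSpin_cont (N := N) (n := n)
  fun_prop

lemma los_eq (i : Fin n) (σ : Om N n) : los i σ = ∑ j ∈ Finset.univ.erase i, (σ j : EE N) := by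
  unfold los totalSpin
  rw [← Finset.add_sum_erase _ _ (Finset.mem_univ i), add_sub_cancel_left]

lemma los_update (i : Fin n) (σ : Om N n) (x : UnitSphere N) : los i (Function.update σ i x) = los i σ := by
  rw [los_eq, los_eq]
  refine Finset.sum_congr rfl fun j hj => ?_
  rw [Function.update_of_ne (Finset.ne_of_mem_erase hj)]

include hβ hn in
lemma JM_loo (i : Fin n) (H : EE N → UnitSphere N → EE N → ℝ)
    (hPG : PG (fun p : EE N × Om N n => H p.1 (p.2 i) (los i p.2)))
    (hz : ∀ y s, ∫ x, H y x s * exp ⟪y, (x : EE N)⟫ ∂μ = 0) :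
    ∫ p, H p.1 (p.2 i) (los i p.2) ∂(JM β μ n) = 0 := by
  rw [JM_integral]
  have hi := hPG.base_int β hβ hn μ
  unfold BM at hi ⊢
  rw [integral_prod _ hi]
  have : ∀ y : EE N, ∫ σ : Om N n, exp (jl β (y, σ)) * H y (σ i) (los i σ) ∂(Measure.pi fun _ : Fin n => μ) = 0 := by
    intro y
    have hc : Continuous (fun σ : Om N n => exp (jl β (y, σ)) * H y (σ i) (los i σ)) :=
      ((jl_cont β).rexp.mul hPG.cont).comp (by fun_prop : Continuous fun σ : Om N n => (y, σ))
    have hmp := resample μ (n := n) i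
    rw [← hmp.map_eq, integral_map hmp.measurable.aemeasurable hc.aestronglyMeasurable]
    have hc2 : Continuous (fun q : Om N n × UnitSphere N => exp (jl β (y, Function.update q.1 i q.2)) * H y (Function.update q.1 i q.2 i) (los i (Function.update q.1 i q.2))) :=
      hc.comp (continuous_fst.update i continuous_snd)
    obtain ⟨C, hC⟩ := (isCompact_univ (X := Om N n × UnitSphere N)).exists_bound_of_continuousOn hc2.continuousOn
    rw [integral_prod]
    · refine integral_eq_zero_of_ae (Filter.Eventually.of_forall fun σ => ?_)
      simp only [Function.update_self, los_update, Pi.zero_apply]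
      have e : ∀ x : UnitSphere N, exp (jl β (y, Function.update σ i x)) * H y x (los i σ) =
          exp (⟪y, los i σ⟫ - n / (2 * β) * ‖y‖^2) * (H y x (los i σ) * exp ⟪y, (x : EE N)⟫) := by
        intro x
        have e1 : totalSpin (Function.update σ i x) = los i σ + x := by
          rw [← los_update i σ x]; simp [los]
        have e2 : jl β (y, Function.update σ i x) = (⟪y, los i σ⟫ - n / (2 * β) * ‖y‖^2) + ⟪y, (x : EE N)⟫ := by
          unfold jl; simp only; rw [e1, inner_add_right]; ring
        rw [e2, exp_add]; ring
      simp_rw [e]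
      rw [integral_const_mul, hz, mul_zero]
    · exact Integrable.of_bound hc2.aestronglyMeasurable C (Filter.Eventually.of_forall fun q => hC q (Set.mem_univ _))
  simp only [this]
  simp

end PartE2

noncomputable section PartG

/-- bounds on a Stein solution -/
structure GG (c : ℝ) (g g' : ℝ → ℝ) : Prop where
  der : ∀ x, HasDerivAt g (g' x) x
  bg : ∀ x, |g x| ≤ c
  bg' : ∀ x, |g' x| ≤ c
  lip : ∀ x y, |g' x - g' y| ≤ c * |x - y|

lemma GG.nonneg {c : ℝ} {g g' : ℝ → ℝ} (h : GG c g g') : 0 ≤ c := (abs_nonneg _).trans (h.bg 0)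

lemma GG.cont {c : ℝ} {g g' : ℝ → ℝ} (h : GG c g g') : Continuous g :=
  continuous_iff_continuousAt.mpr fun x => (h.der x).continuousAt

lemma GG.cont' {c : ℝ} {g g' : ℝ → ℝ} (h : GG c g g') : Continuous g' := by
  have : LipschitzWith c.toNNReal g' := LipschitzWith.of_dist_le_mul fun a d => by
    simpa [Real.dist_eq, h.nonneg] using h.lip a d
  exact this.continuous

lemma GG.taylor {c : ℝ} {g g' : ℝ → ℝ} (h : GG c g g') (x y : ℝ) :
    |g y - g x - g' x * (y - x)| ≤ c * (y - x)^2 := by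
  have hc := h.nonneg
  have := Convex.norm_image_sub_le_of_norm_hasDerivWithin_le (f := fun t => g t - g' x * t) (f' := fun t => g' t - g' x)
    (s := Set.uIcc x y) (C := c * |y - x|) (x := x) (y := y)
    (fun t _ => by
      have := (h.der t).sub ((hasDerivAt_id t).const_mul (g' x))
      simp only [mul_one] at this
      exact this.hasDerivWithinAt) (fun t ht => ?_) (convex_uIcc x y) Set.left_mem_uIcc Set.right_mem_uIcc
  · simp only [Real.norm_eq_abs] at this
    calc _ = |g y - g' x * y - (g x - g' x * x)| := by congr 1; ring
      _ ≤ c * |y - x| * |y - x| := this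
      _ = _ := by rw [mul_assoc, ← sq, sq_abs]
  · refine (h.lip t x).trans ?_
    exact mul_le_mul_of_nonneg_left (Set.abs_sub_left_of_mem_uIcc ht) hc

variable {N n : ℕ}

/-- W as a function of the spin -/
def wS (n : ℕ) (β b : ℝ) (S : EE N) : ℝ := √n * (β ^ 2 / ((n : ℝ) ^ 2 * b ^ 2) * ‖S‖ ^ 2 - 1)

lemma Wspin_eq (β b : ℝ) (σ : Om N n) : Wspin N n β b σ = wS n β b (totalSpin σ) := rfl

lemma wS_cont (β b : ℝ) : Continuous (wS n β b : EE N → ℝ) := by unfold wS; fun_prop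

/-- centred variable -/
def ai (y : EE N) (x : UnitSphere N) : ℝ := ⟪y, (x : EE N)⟫ - ‖y‖^2 * Kf N ‖y‖

lemma ai_le (hN : 2 ≤ N) (y : EE N) (x : UnitSphere N) : |ai y x| ≤ 2 * ‖y‖ := by
  unfold ai
  have h1 := abs_real_inner_le_norm y (x : EE N)
  rw [sph_norm, mul_one] at h1
  have h2 := mul_Kf_le_one N hN ‖y‖
  have h3 := Kf_pos N hN ‖y‖
  have h4 : |‖y‖^2 * Kf N ‖y‖| ≤ ‖y‖ := by
    rw [abs_of_nonneg (by positivity), sq, mul_assoc]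
    exact mul_le_of_le_one_right (norm_nonneg _) h2
  calc _ ≤ _ := abs_sub _ _
    _ ≤ ‖y‖ + ‖y‖ := add_le_add h1 h4
    _ = _ := by ring

lemma inner_sph_le (y : EE N) (x : UnitSphere N) : |⟪y, (x : EE N)⟫| ≤ ‖y‖ := by
  have h1 := abs_real_inner_le_norm y (x : EE N)
  rwa [sph_norm, mul_one] at h1

lemma w_diff (hn : 1 ≤ n) (β b : ℝ) (hb : 0 < b) (i : Fin n) (σ : Om N n) :
    wS n β b (totalSpin σ) - wS n β b (los i σ) = β^2 / (n * √n * b^2) * (2 * ⟪totalSpin σ, (σ i : EE N)⟫ - 1) := by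
  have hn' : (0:ℝ) < n := by exact_mod_cast hn
  have hs : 0 < √(n:ℝ) := by positivity
  have hsq : √(n:ℝ)^2 = n := sq_sqrt hn'.le
  unfold wS los
  rw [norm_sub_sq_real, sph_norm]
  generalize √(n:ℝ) = s at *
  rw [← hsq]
  field_simp
  ring

lemma w_diff_abs (hn : 1 ≤ n) (β b : ℝ) (hb : 0 < b) (i : Fin n) (σ : Om N n) :
    |wS n β b (totalSpin σ) - wS n β b (los i σ)| ≤ 3 * β^2 / b^2 / √n := by
  have hn' : (1:ℝ) ≤ n := by exact_mod_cast hn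
  have hs : 0 < √(n:ℝ) := by positivity
  rw [w_diff hn β b hb, abs_mul, abs_of_nonneg (by positivity : 0 ≤ β^2 / (n * √n * b^2))]
  have h1 : |2 * ⟪totalSpin σ, (σ i : EE N)⟫ - 1| ≤ 3 * n := by
    have h2 := (inner_sph_le (totalSpin σ) (σ i)).trans (totalSpin_norm_le σ)
    rw [abs_le] at h2 ⊢
    constructor <;> linarith
  calc _ ≤ β^2 / (n * √n * b^2) * (3 * n) := by gcongr
    _ = _ := by field_simp

lemma w_diff_lin (hn : 1 ≤ n) (β b : ℝ) (hβ : 0 < β) (hb : 0 < b) (i : Fin n) (y : EE N) (σ : Om N n) :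
    |wS n β b (totalSpin σ) - wS n β b (los i σ) - 2 * β / (√n * b^2) * ⟪y, (σ i : EE N)⟫| ≤
      2 * β / (√n * b^2) * ‖y - sv β σ‖ + β^2 / (n * √n * b^2) := by
  have hn' : (1:ℝ) ≤ n := by exact_mod_cast hn
  have hs : 0 < √(n:ℝ) := by positivity
  have e : wS n β b (totalSpin σ) - wS n β b (los i σ) - 2 * β / (√n * b^2) * ⟪y, (σ i : EE N)⟫ =
      -(2 * β / (√n * b^2) * ⟪y - sv β σ, (σ i : EE N)⟫) - β^2 / (n * √n * b^2) := by
    rw [w_diff hn β b hb, inner_sub_left, sv, real_inner_smul_left]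
    field_simp
    ring
  rw [e]
  refine (abs_sub _ _).trans ?_
  rw [abs_neg, abs_mul, abs_of_nonneg (by positivity : 0 ≤ β^2 / (n * √n * b^2)), abs_of_nonneg (by positivity : 0 ≤ 2 * β / (√n * b^2))]
  gcongr
  exact inner_sph_le _ _

/-- first error term -/
lemma err1 (hN : 2 ≤ N) (hn : 1 ≤ n) (β b : ℝ) (hβ : 0 < β) (hb : 0 < b) {c : ℝ} {g g' : ℝ → ℝ} (h : GG c g g')
    (i : Fin n) (y : EE N) (σ : Om N n) :
    |ai y (σ i) * (g (wS n β b (totalSpin σ)) - g (wS n β b (los i σ))) -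
      2 * β / (√n * b^2) * (ai y (σ i) * ⟪y, (σ i : EE N)⟫ * g' (wS n β b (los i σ)))| ≤
    c / n * ((1 + ‖y‖^2) * ((3 * β^2 / b^2)^2 + β^2 / b^2) + 2 * β / b^2 * (‖y‖^2 + n * ‖y - sv β σ‖^2)) := by
  have hn' : (1:ℝ) ≤ n := by exact_mod_cast hn
  have hs : 0 < √(n:ℝ) := by positivity
  have hs1 : 1 ≤ √(n:ℝ) := Real.one_le_sqrt.mpr hn'
  have hsq : √(n:ℝ)^2 = n := sq_sqrt (by linarith)
  have hc := h.nonneg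
  have d1 := w_diff_abs hn β b hb i σ
  have d2 := w_diff_lin hn β b hβ hb i y σ
  have d3 := h.taylor (wS n β b (los i σ)) (wS n β b (totalSpin σ))
  have d4 := h.bg' (wS n β b (los i σ))
  have ha := ai_le hN y (σ i)
  set w := wS n β b (totalSpin σ)
  set w0 := wS n β b (los i σ)
  set z := ‖y - sv β σ‖ with hz
  have hz0 : 0 ≤ z := norm_nonneg _
  have hy0 : 0 ≤ ‖y‖ := norm_nonneg _
  set r := ‖y‖
  have d5 : (w - w0)^2 ≤ (3 * β^2 / b^2)^2 / n := by
    rw [← sq_abs]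
    calc |w - w0|^2 ≤ (3 * β^2 / b^2 / √n)^2 := by gcongr
      _ = _ := by rw [div_pow (3 * β^2 / b^2) (√(n:ℝ)), hsq]
  have e : ai y (σ i) * (g w - g w0) - 2 * β / (√n * b^2) * (ai y (σ i) * ⟪y, (σ i : EE N)⟫ * g' w0) =
      ai y (σ i) * ((g w - g w0 - g' w0 * (w - w0)) + g' w0 * (w - w0 - 2 * β / (√n * b^2) * ⟪y, (σ i : EE N)⟫)) := by ring
  rw [e, abs_mul]
  have d6 : |(g w - g w0 - g' w0 * (w - w0)) + g' w0 * (w - w0 - 2 * β / (√n * b^2) * ⟪y, (σ i : EE N)⟫)| ≤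
      c * ((3 * β^2 / b^2)^2 / n) + c * (2 * β / (√n * b^2) * z + β^2 / (n * √n * b^2)) := by
    refine (abs_add_le _ _).trans (add_le_add (d3.trans ?_) ?_)
    · gcongr
    · rw [abs_mul]; gcongr
  calc _ ≤ (2 * r) * (c * ((3 * β^2 / b^2)^2 / n) + c * (2 * β / (√n * b^2) * z + β^2 / (n * √n * b^2))) := by gcongr
    _ = c / n * (2 * r * ((3 * β^2 / b^2)^2 + β^2 / b^2 / √n) + 2 * β / b^2 * (2 * r * (√n * z))) := by
        field_simp
        rw [hsq]
        ring
    _ ≤ _ := by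
        have f1 : 2 * r ≤ 1 + r^2 := by nlinarith [sq_nonneg (r - 1)]
        have f2 : 2 * r * (√n * z) ≤ r^2 + n * z^2 := by
          have : n * z^2 = (√n * z)^2 := by rw [mul_pow, hsq]
          rw [this]; nlinarith [sq_nonneg (r - √n * z)]
        have f3 : β^2 / b^2 / √n ≤ β^2 / b^2 := div_le_self (by positivity) hs1
        gcongr

/-- second error term -/
lemma err2 (hn : 1 ≤ n) (β b : ℝ) (hb : 0 < b) {c : ℝ} {g g' : ℝ → ℝ} (h : GG c g g')
    (V : ℝ → ℝ) (CV : ℝ) (hCV : 0 ≤ CV) (hV : ∀ r, 0 ≤ r → |r^2 * V r - b^2 * V b| ≤ CV * |r^2 - b^2|) (hVb : |V b| ≤ 1)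
    (i : Fin n) (y : EE N) (σ : Om N n) :
    |‖y‖^2 * V ‖y‖ * g' (wS n β b (los i σ)) - b^2 * V b * g' (wS n β b (totalSpin σ))| ≤
      c / √n * (CV * (1 + n * (‖y‖^2 - b^2)^2) + 3 * β^2) := by
  have hn' : (1:ℝ) ≤ n := by exact_mod_cast hn
  have hs : 0 < √(n:ℝ) := by positivity
  have hsq : √(n:ℝ)^2 = n := sq_sqrt (by linarith)
  have hc := h.nonneg
  have d1 := w_diff_abs hn β b hb i σ
  have d4 := h.bg' (wS n β b (los i σ))
  have d5 := h.lip (wS n β b (los i σ)) (wS n β b (totalSpin σ))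
  rw [abs_sub_comm (wS n β b (los i σ)) (wS n β b (totalSpin σ))] at d5
  have d6 := hV ‖y‖ (norm_nonneg y)
  set w := wS n β b (totalSpin σ)
  set w0 := wS n β b (los i σ)
  set x := ‖y‖^2 - b^2
  have f1 : |x| ≤ (1 + n * x^2) / √n := by
    rw [le_div_iff₀ hs]
    have : n * x^2 = (|x| * √n)^2 := by rw [mul_pow, hsq, sq_abs]; ring
    rw [this]; nlinarith [sq_nonneg (|x| * √n - 1), abs_nonneg x]
  have e : ‖y‖^2 * V ‖y‖ * g' w0 - b^2 * V b * g' w = (‖y‖^2 * V ‖y‖ - b^2 * V b) * g' w0 + b^2 * V b * (g' w0 - g' w) := by ring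
  rw [e]
  calc _ ≤ |(‖y‖^2 * V ‖y‖ - b^2 * V b) * g' w0| + |b^2 * V b * (g' w0 - g' w)| := abs_add_le _ _
    _ = |‖y‖^2 * V ‖y‖ - b^2 * V b| * |g' w0| + b^2 * |V b| * |g' w0 - g' w| := by
        rw [abs_mul, abs_mul, abs_mul, abs_of_nonneg (sq_nonneg b)]
    _ ≤ (CV * ((1 + n * x^2) / √n)) * c + b^2 * 1 * (c * (3 * β^2 / b^2 / √n)) := by
        gcongr
        · exact d6.trans (by gcongr)
        · exact d5.trans (by gcongr)
    _ = _ := by field_simp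

end PartG

noncomputable section PartH

variable {N n : ℕ}
variable (β : ℝ) (hβ : 0 < β) (hn : 1 ≤ n) (μ : Measure (UnitSphere N)) [IsProbabilityMeasure μ]

include hβ hn in
lemma JM_mono {F G : EE N × Om N n → ℝ} (hF : PG F) (hG : PG G) (h : ∀ p, F p ≤ G p) :
    ∫ p, F p ∂(JM β μ n) ≤ ∫ p, G p ∂(JM β μ n) :=
  integral_mono (hF.int β hβ hn μ) (hG.int β hβ hn μ) h

include hβ hn in
lemma JM_abs_le {F G : EE N × Om N n → ℝ} (hF : PG F) (hG : PG G) (h : ∀ p, |F p| ≤ G p) :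
    |∫ p, F p ∂(JM β μ n)| ≤ ∫ p, G p ∂(JM β μ n) :=
  (abs_integral_le_integral_abs).trans (JM_mono β hβ hn μ hF.abs hG h)

include hβ hn in
lemma JM_const (c : ℝ) : ∫ _p, c ∂(JM β μ n) = c := by
  have := JM_prob β hβ hn μ
  simp

include hβ hn in
lemma JM_add {F G : EE N × Om N n → ℝ} (hF : PG F) (hG : PG G) :
    ∫ p, (F p + G p) ∂(JM β μ n) = ∫ p, F p ∂(JM β μ n) + ∫ p, G p ∂(JM β μ n) :=
  integral_add (hF.int β hβ hn μ) (hG.int β hβ hn μ)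

include hβ hn in
lemma JM_sub {F G : EE N × Om N n → ℝ} (hF : PG F) (hG : PG G) :
    ∫ p, (F p - G p) ∂(JM β μ n) = ∫ p, F p ∂(JM β μ n) - ∫ p, G p ∂(JM β μ n) :=
  integral_sub (hF.int β hβ hn μ) (hG.int β hβ hn μ)

include hβ hn in
lemma JM_z2 : ∫ p, ‖p.1 - sv β p.2‖^2 ∂(JM β μ n) = vc N β / n := by
  have := JM_var β hβ hn μ (n := n) (φ := fun _ => 1) continuous_const
  simpa [JM_const β hβ hn μ] using this

lemma PG.rho : PG (fun p : EE N × Om N n => ‖p.1‖^2) := PG.norm_fst.pow 2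

lemma PG.dev (b : ℝ) : PG (fun p : EE N × Om N n => (‖p.1‖^2 - b^2)^2) := (PG.rho.sub (PG.const _)).pow 2

include hβ hn in
lemma JM_rho (b C3 : ℝ) (h3 : ∫ p, (‖p.1‖^2 - b^2)^2 ∂(JM β μ n) ≤ C3 / n) (hC3 : 0 ≤ C3) :
    ∫ p, ‖p.1‖^2 ∂(JM β μ n) ≤ b^2 + 1 + C3 := by
  have hn' : (1:ℝ) ≤ n := by exact_mod_cast hn
  have h1 := JM_mono β hβ hn μ PG.rho ((PG.const (b^2+1)).add (PG.dev (N := N) (n := n) b)) (fun p => by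
    nlinarith [sq_nonneg (‖p.1‖^2 - b^2 - 1)])
  rw [JM_add β hβ hn μ (PG.const _) (PG.dev b), JM_const β hβ hn μ] at h1
  have : C3 / n ≤ C3 := div_le_self hC3 hn'
  linarith

lemma PG.K (hN : 2 ≤ N) : PG (fun p : EE N × Om N n => Kf N ‖p.1‖) :=
  PG.bdd_norm (Kf_continuous N hN) 1 fun r _ => by
    rw [abs_of_pos (Kf_pos N hN r)]; exact Kf_le_one N hN r

lemma PG.V (hN : 2 ≤ N) : PG (fun p : EE N × Om N n => Vf N ‖p.1‖) :=
  PG.bdd_norm (by have := Kf_continuous N hN; unfold Vf; fun_prop) 1 fun r hr => Vf_abs_le N hN r hr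

lemma PG.innersph (i : Fin n) : PG (fun p : EE N × Om N n => ⟪p.1, (p.2 i : EE N)⟫) :=
  PG.inner_fst (u := fun σ => (σ i : EE N)) (by fun_prop)

lemma PG.a (hN : 2 ≤ N) (i : Fin n) : PG (fun p : EE N × Om N n => ai p.1 (p.2 i)) :=
  (PG.innersph i).sub (PG.rho.mul (PG.K hN))

lemma PG.gW {g : ℝ → ℝ} (hg : Continuous g) (b : ℝ) : PG (fun p : EE N × Om N n => g (wS n β b (totalSpin p.2))) :=
  PG.snd (φ := fun σ => g (wS n β b (totalSpin σ))) (hg.comp ((wS_cont β b).comp totalSpin_cont))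

lemma PG.gW0 {g : ℝ → ℝ} (hg : Continuous g) (b : ℝ) (i : Fin n) : PG (fun p : EE N × Om N n => g (wS n β b (los i p.2))) :=
  PG.snd (φ := fun σ => g (wS n β b (los i σ))) (hg.comp ((wS_cont β b).comp (los_cont i)))

variable (hμinv : ∀ e : EuclideanSpace ℝ (Fin N) ≃ₗᵢ[ℝ] EuclideanSpace ℝ (Fin N), Measure.map (sphereMap e) μ = μ)

include hβ hn hμinv in
lemma stepD_i (hN : 2 ≤ N) (b : ℝ) (hb : 0 < b) (C3 : ℝ) (hC3 : 0 ≤ C3)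
    (h3 : ∫ p, (‖p.1‖^2 - b^2)^2 ∂(JM β μ n) ≤ C3 / n)
    (CV : ℝ) (hCV : 0 ≤ CV) (hV : ∀ r, 0 ≤ r → |r^2 * Vf N r - b^2 * Vf N b| ≤ CV * |r^2 - b^2|)
    {c : ℝ} {g g' : ℝ → ℝ} (h : GG c g g') (i : Fin n) :
    |∫ p, ai p.1 (p.2 i) * g (wS n β b (totalSpin p.2)) ∂(JM β μ n) -
      2 * β / √n * Vf N b * ∫ p, g' (wS n β b (totalSpin p.2)) ∂(JM β μ n)| ≤
    (c * ((1 + (b^2 + 1 + C3)) * ((3 * β^2 / b^2)^2 + β^2 / b^2) + 2 * β / b^2 * ((b^2 + 1 + C3) + vc N β)) +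
      2 * β / b^2 * (c * (CV * (1 + C3) + 3 * β^2))) / n := by
  have hn' : (1:ℝ) ≤ n := by exact_mod_cast hn
  have hs : 0 < √(n:ℝ) := by positivity
  have hsq : √(n:ℝ)^2 = n := sq_sqrt (by linarith)
  have hc := h.nonneg
  have hρ := JM_rho β hβ hn μ b C3 h3 hC3
  have hz := JM_z2 β hβ hn μ (n := n)
  have pa := PG.a (n := n) hN i
  have pg := PG.gW (N := N) (n := n) β h.cont b
  have pg' := PG.gW (N := N) (n := n) β h.cont' b
  have pg0 := PG.gW0 (N := N) (n := n) β h.cont b i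
  have pg0' := PG.gW0 (N := N) (n := n) β h.cont' b i
  have pin := PG.innersph (N := N) i
  have pV := PG.V (N := N) (n := n) hN
  have pρ := PG.rho (N := N) (n := n)
  have pz := PG.zsq (N := N) (n := n) β
  have pd := PG.dev (N := N) (n := n) b
  -- vanishing terms
  have v1 : ∫ p, ai p.1 (p.2 i) * g (wS n β b (los i p.2)) ∂(JM β μ n) = 0 := by
    refine JM_loo β hβ hn μ i (fun y x s => ai y x * g (wS n β b s)) (pa.mul pg0) fun y s => ?_
    have e : ∀ x : UnitSphere N, ai y x * g (wS n β b s) * exp ⟪y, (x : EE N)⟫ =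
        ((⟪y, (x : EE N)⟫ - ‖y‖^2 * Kf N ‖y‖) * exp ⟪y, (x : EE N)⟫) * g (wS n β b s) := fun x => by unfold ai; ring
    simp_rw [e]
    rw [integral_mul_const, sph_m1 hN μ hμinv y, zero_mul]
  have v2 : ∫ p, (ai p.1 (p.2 i) * ⟪p.1, (p.2 i : EE N)⟫ - ‖p.1‖^2 * Vf N ‖p.1‖) * g' (wS n β b (los i p.2)) ∂(JM β μ n) = 0 := by
    refine JM_loo β hβ hn μ i (fun y x s => (ai y x * ⟪y, (x : EE N)⟫ - ‖y‖^2 * Vf N ‖y‖) * g' (wS n β b s))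
      (((pa.mul pin).sub (pρ.mul pV)).mul pg0') fun y s => ?_
    have e : ∀ x : UnitSphere N, (ai y x * ⟪y, (x : EE N)⟫ - ‖y‖^2 * Vf N ‖y‖) * g' (wS n β b s) * exp ⟪y, (x : EE N)⟫ =
        (((⟪y, (x : EE N)⟫ - ‖y‖^2 * Kf N ‖y‖) * ⟪y, (x : EE N)⟫ - ‖y‖^2 * Vf N ‖y‖) * exp ⟪y, (x : EE N)⟫) * g' (wS n β b s) := fun x => by unfold ai; ring
    simp_rw [e]
    rw [integral_mul_const, sph_m2 hN μ hμinv y, zero_mul]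
  have v3 : ∫ p, ai p.1 (p.2 i) * ⟪p.1, (p.2 i : EE N)⟫ * g' (wS n β b (los i p.2)) ∂(JM β μ n) =
      ∫ p, ‖p.1‖^2 * Vf N ‖p.1‖ * g' (wS n β b (los i p.2)) ∂(JM β μ n) := by
    have := JM_sub β hβ hn μ ((pa.mul pin).mul pg0') ((pρ.mul pV).mul pg0')
    simp_rw [← sub_mul] at this
    linarith
  -- first error
  have w1 := JM_abs_le β hβ hn μ ((pa.mul (pg.sub pg0)).sub ((PG.const (2 * β / (√n * b^2))).mul ((pa.mul pin).mul pg0')))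
    ((PG.const (c / n)).mul ((((PG.const 1).add pρ).mul (PG.const ((3 * β^2 / b^2)^2 + β^2 / b^2))).add
      ((PG.const (2 * β / b^2)).mul (pρ.add ((PG.const (n:ℝ)).mul pz)))))
    (fun p => err1 hN hn β b hβ hb h i p.1 p.2)
  rw [JM_sub β hβ hn μ (pa.mul (pg.sub pg0)) ((PG.const (2 * β / (√n * b^2))).mul ((pa.mul pin).mul pg0')),
    integral_const_mul, integral_const_mul,
    JM_add β hβ hn μ (((PG.const 1).add pρ).mul (PG.const ((3 * β^2 / b^2)^2 + β^2 / b^2)))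
      ((PG.const (2 * β / b^2)).mul (pρ.add ((PG.const (n:ℝ)).mul pz))), integral_mul_const, integral_const_mul,
    JM_add β hβ hn μ (PG.const 1) pρ, JM_add β hβ hn μ pρ ((PG.const (n:ℝ)).mul pz), integral_const_mul, JM_const β hβ hn μ, hz, v3] at w1
  simp_rw [mul_sub] at w1
  rw [JM_sub β hβ hn μ (pa.mul pg) (pa.mul pg0), v1, sub_zero] at w1
  -- second error
  have w2 := JM_abs_le β hβ hn μ (((pρ.mul pV).mul pg0').sub ((PG.const (b^2 * Vf N b)).mul pg'))
    ((PG.const (c / √n)).mul (((PG.const CV).mul ((PG.const 1).add ((PG.const (n:ℝ)).mul pd))).add (PG.const (3 * β^2))))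
    (fun p => err2 hn β b hb h (Vf N) CV hCV hV (Vf_abs_le N hN b hb.le) i p.1 p.2)
  rw [JM_sub β hβ hn μ ((pρ.mul pV).mul pg0') ((PG.const (b^2 * Vf N b)).mul pg'), integral_const_mul, integral_const_mul,
    JM_add β hβ hn μ ((PG.const CV).mul ((PG.const 1).add ((PG.const (n:ℝ)).mul pd))) (PG.const (3 * β^2)), integral_const_mul,
    JM_add β hβ hn μ (PG.const 1) ((PG.const (n:ℝ)).mul pd), integral_const_mul, JM_const β hβ hn μ, JM_const β hβ hn μ] at w2
  generalize (∫ p, ai p.1 (p.2 i) * g (wS n β b (totalSpin p.2)) ∂(JM β μ n)) = A at *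
  generalize (∫ p, ‖p.1‖^2 * Vf N ‖p.1‖ * g' (wS n β b (los i p.2)) ∂(JM β μ n)) = D at *
  generalize (∫ p, g' (wS n β b (totalSpin p.2)) ∂(JM β μ n)) = G at *
  generalize (∫ p, (‖p.1‖^2 - b^2)^2 ∂(JM β μ n)) = X at *
  generalize (∫ p, ‖p.1‖^2 ∂(JM β μ n)) = R at *
  have u1 : |A - 2 * β / (√n * b^2) * D| ≤ c / n * ((1 + (b^2 + 1 + C3)) * ((3 * β^2 / b^2)^2 + β^2 / b^2) + 2 * β / b^2 * ((b^2 + 1 + C3) + vc N β)) := by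
    refine w1.trans ?_
    rw [mul_div_cancel₀ _ (by positivity : (n:ℝ) ≠ 0)]
    gcongr
  have u2 : |D - b^2 * Vf N b * G| ≤ c / √n * (CV * (1 + C3) + 3 * β^2) := by
    refine w2.trans ?_
    have : n * X ≤ C3 := by rw [le_div_iff₀' (by positivity)] at h3; exact h3
    gcongr
  have e : A - 2 * β / √n * Vf N b * G = (A - 2 * β / (√n * b^2) * D) + 2 * β / (√n * b^2) * (D - b^2 * Vf N b * G) := by
    field_simp
    ring
  rw [e]
  refine (abs_add_le _ _).trans ?_
  rw [abs_mul, abs_of_nonneg (by positivity : 0 ≤ 2 * β / (√n * b^2))]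
  calc _ ≤ c / n * ((1 + (b^2 + 1 + C3)) * ((3 * β^2 / b^2)^2 + β^2 / b^2) + 2 * β / b^2 * ((b^2 + 1 + C3) + vc N β)) +
        2 * β / (√n * b^2) * (c / √n * (CV * (1 + C3) + 3 * β^2)) := by gcongr
    _ = c / n * ((1 + (b^2 + 1 + C3)) * ((3 * β^2 / b^2)^2 + β^2 / b^2) + 2 * β / b^2 * ((b^2 + 1 + C3) + vc N β)) +
        2 * β / b^2 * (c * (CV * (1 + C3) + 3 * β^2)) / √n^2 := by
        congr 1
        field_simp
    _ = _ := by rw [hsq]; ring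

end PartH

noncomputable section PartI

variable {N n : ℕ}
variable (β : ℝ) (hβ : 0 < β) (hn : 1 ≤ n) (μ : Measure (UnitSphere N)) [IsProbabilityMeasure μ]

include hβ hn in
lemma point_id (b α : ℝ) (hb : 0 < b) (G : ℝ) (y : EE N) (σ : Om N n) :
    (∑ i, ai y (σ i) * G) - √n * α * b^2 * (wS n β b (totalSpin σ) * G) =
      n * (((1 / β - Kf N ‖y‖) * ‖y‖^2 - α * (‖y‖^2 - b^2)) * G) +
      ((n * α - n / β) * (‖y - sv β σ‖^2 * G) + (2 * n * α - n / β) * ⟪y - sv β σ, G • sv β σ⟫) := by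
  have hn0 : (0:ℝ) < n := by exact_mod_cast hn
  have hs : 0 < √(n:ℝ) := by positivity
  have hsq : √(n:ℝ)^2 = n := sq_sqrt (by linarith)
  have e1 : (∑ i, ai y (σ i) * G) = (⟪y, totalSpin σ⟫ - n * (‖y‖^2 * Kf N ‖y‖)) * G := by
    rw [← Finset.sum_mul]
    congr 1
    simp only [ai, totalSpin, Finset.sum_sub_distrib, inner_sum]
    simp
  have e2 : ⟪y, sv β σ⟫ = β / n * ⟪y, totalSpin σ⟫ := by
    rw [sv, inner_smul_right]
  have e3 : ‖sv β σ‖^2 = β^2 / n^2 * ‖totalSpin σ‖^2 := by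
    rw [sv, norm_smul, mul_pow, Real.norm_eq_abs, sq_abs, div_pow]
  have e4 : √n * b^2 * wS n β b (totalSpin σ) = n * (‖sv β σ‖^2 - b^2) := by
    rw [e3, wS]
    have : √(n:ℝ) * b^2 * (√n * (β ^ 2 / ((n : ℝ) ^ 2 * b ^ 2) * ‖totalSpin σ‖ ^ 2 - 1)) =
      √(n:ℝ)^2 * (b^2 * (β ^ 2 / ((n : ℝ) ^ 2 * b ^ 2) * ‖totalSpin σ‖ ^ 2 - 1)) := by ring
    rw [this, hsq]
    field_simp
  have e5 : ‖y - sv β σ‖^2 = ‖y‖^2 - 2 * ⟪y, sv β σ⟫ + ‖sv β σ‖^2 := norm_sub_sq_real _ _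
  have e6 : ⟪y - sv β σ, G • sv β σ⟫ = G * (⟪y, sv β σ⟫ - ‖sv β σ‖^2) := by
    rw [inner_smul_right, inner_sub_left, real_inner_self_eq_norm_sq]
  have e7 : ⟪y, totalSpin σ⟫ = n / β * ⟪y, sv β σ⟫ := by rw [e2]; field_simp
  have e8 : √n * α * b^2 * (wS n β b (totalSpin σ) * G) = α * G * (n * (‖sv β σ‖^2 - b^2)) := by
    rw [← e4]; ring
  rw [e1, e7, e8, e6, e5]
  field_simp
  ring

variable (hμinv : ∀ e : EuclideanSpace ℝ (Fin N) ≃ₗᵢ[ℝ] EuclideanSpace ℝ (Fin N), Measure.map (sphereMap e) μ = μ)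

include hβ hn in
lemma stepABC (hN : 2 ≤ N) (b : ℝ) (hb : 0 < b) (C3 : ℝ)
    (h3 : ∫ p, (‖p.1‖^2 - b^2)^2 ∂(JM β μ n) ≤ C3 / n) (α CK : ℝ) (hα : 0 ≤ α) (hCK : 0 ≤ CK)
    (hK : ∀ r, 0 ≤ r → |(1 / β - Kf N r) * r^2 - α * (r^2 - b^2)| ≤ CK * (r^2 - b^2)^2)
    {c : ℝ} {g g' : ℝ → ℝ} (h : GG c g g') :
    |∑ i, ∫ p, ai p.1 (p.2 i) * g (wS n β b (totalSpin p.2)) ∂(JM β μ n) -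
      √n * α * b^2 * ∫ p, wS n β b (totalSpin p.2) * g (wS n β b (totalSpin p.2)) ∂(JM β μ n)| ≤
    c * (CK * C3 + (α + 1 / β) * vc N β) := by
  have hn0 : (0:ℝ) < n := by exact_mod_cast hn
  have hc := h.nonneg
  have hv := vc_nonneg (N := N) β
  have pg := PG.gW (N := N) (n := n) β h.cont b
  have pw := PG.gW (N := N) (n := n) β continuous_id b
  simp only [id] at pw
  have pρ := PG.rho (N := N) (n := n)
  have pd := PG.dev (N := N) (n := n) b
  have pK := PG.K (n := n) hN
  have pz := PG.zsq (N := N) (n := n) β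
  have cg : Continuous fun σ : Om N n => g (wS n β b (totalSpin σ)) := h.cont.comp ((wS_cont β b).comp totalSpin_cont)
  have cu : Continuous fun σ : Om N n => g (wS n β b (totalSpin σ)) • sv β σ := cg.smul (sv_cont β)
  have pi := PG.zinner (N := N) (n := n) β cu
  have pA := fun i => (PG.a (n := n) hN i).mul pg
  have pE := ((((PG.const (1 / β)).sub pK).mul pρ).sub ((PG.const α).mul (pρ.sub (PG.const (b^2))))).mul pg
  have I0 : ∑ i, ∫ p, ai p.1 (p.2 i) * g (wS n β b (totalSpin p.2)) ∂(JM β μ n) =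
      ∫ p, ∑ i, ai p.1 (p.2 i) * g (wS n β b (totalSpin p.2)) ∂(JM β μ n) :=
    (integral_finsetSum _ fun i _ => (pA i).int β hβ hn μ).symm
  have I1 := JM_sub β hβ hn μ (PG.sum Finset.univ pA) ((PG.const (√n * α * b^2)).mul (pw.mul pg))
  rw [integral_const_mul] at I1
  rw [I0, ← I1]
  simp_rw [point_id β hβ hn b α hb]
  rw [JM_add β hβ hn μ ((PG.const (n:ℝ)).mul pE) (((PG.const (n * α - n / β)).mul (pz.mul pg)).add ((PG.const (2 * n * α - n / β)).mul pi)),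
    JM_add β hβ hn μ ((PG.const (n * α - n / β)).mul (pz.mul pg)) ((PG.const (2 * n * α - n / β)).mul pi),
    integral_const_mul, integral_const_mul, integral_const_mul, JM_odd β hβ hn μ cu, JM_var β hβ hn μ cg, mul_zero, add_zero]
  have b1 := JM_abs_le β hβ hn μ pE ((PG.const (c * CK)).mul pd) (fun p => by
    rw [abs_mul]
    calc _ ≤ CK * (‖p.1‖^2 - b^2)^2 * c := mul_le_mul (hK _ (norm_nonneg _)) (h.bg _) (abs_nonneg _) (by positivity)
      _ = _ := by ring)
  rw [integral_const_mul] at b1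
  have b2 := JM_abs_le β hβ hn μ pg (PG.const c) (fun p => h.bg _)
  rw [JM_const β hβ hn μ] at b2
  generalize (∫ p, g (wS n β b (totalSpin p.2)) ∂(JM β μ n)) = Y at *
  generalize (∫ p, ((1 / β - Kf N ‖p.1‖) * ‖p.1‖^2 - α * (‖p.1‖^2 - b^2)) * g (wS n β b (totalSpin p.2)) ∂(JM β μ n)) = X at *
  have b3 : n * |X| ≤ c * CK * C3 := by
    calc _ ≤ n * (c * CK * (C3 / n)) := by
          refine mul_le_mul_of_nonneg_left (b1.trans ?_) hn0.le
          exact mul_le_mul_of_nonneg_left h3 (by positivity)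
      _ = _ := by field_simp
  have e : (n * α - n / β) * (vc N β / n * Y) = (α - 1 / β) * (vc N β * Y) := by field_simp
  rw [e]
  have b4 : |(α - 1 / β) * (vc N β * Y)| ≤ (α + 1 / β) * (vc N β * c) := by
    rw [abs_mul, abs_mul, abs_of_nonneg hv]
    have : |α - 1 / β| ≤ α + 1 / β := by
      have : 0 < 1 / β := by positivity
      rw [abs_le]; constructor <;> linarith
    gcongr
  calc _ ≤ _ := abs_add_le _ _
    _ ≤ c * CK * C3 + (α + 1 / β) * (vc N β * c) := by
      refine add_le_add ?_ b4
      rw [abs_mul, abs_of_pos hn0]; exact b3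
    _ = _ := by ring

include hβ hμinv in
lemma stein_bound (hN : 2 ≤ N) (b : ℝ) (hb : 0 < b) (hKb : Kf N b = 1 / β) (c : ℝ) :
    ∃ C, 0 ≤ C ∧ ∀ n : ℕ, 1 ≤ n → ∀ g g' : ℝ → ℝ, GG c g g' →
      |(-Kd N b * b / 2) * b^2 * ∫ p, wS n β b (totalSpin p.2) * g (wS n β b (totalSpin p.2)) ∂(JM β μ n) -
        2 * β * Vf N b * ∫ p, g' (wS n β b (totalSpin p.2)) ∂(JM β μ n)| ≤ C / √n := by
  obtain ⟨C3, hC3, h3⟩ := JM_conc β hβ μ hμinv hN b hb hKb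
  obtain ⟨CV, hCV, hV⟩ := V_lip N hN b hb
  obtain ⟨CK, hCK, hK⟩ := K_quad N hN b hb
  rw [hKb] at hK
  have hα : 0 ≤ -Kd N b * b / 2 := by
    have := Kd_neg N hN b hb
    have : 0 ≤ -Kd N b * b := mul_nonneg (by linarith) hb.le
    linarith
  set α := -Kd N b * b / 2 with hαd
  set C1 := c * (CK * C3 + (α + 1 / β) * vc N β)
  set C2 := c * ((1 + (b^2 + 1 + C3)) * ((3 * β^2 / b^2)^2 + β^2 / b^2) + 2 * β / b^2 * ((b^2 + 1 + C3) + vc N β)) +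
      2 * β / b^2 * (c * (CV * (1 + C3) + 3 * β^2)) with hC2
  refine ⟨|C1 + C2|, abs_nonneg _, fun n hn g g' h => ?_⟩
  have hn0 : (0:ℝ) < n := by exact_mod_cast hn
  have hs : 0 < √(n:ℝ) := by positivity
  have hsq : √(n:ℝ) * √n = n := mul_self_sqrt (by linarith)
  have a1 := stepABC β hβ hn μ hN b hb C3 (h3 n hn) α CK hα hCK.le hK h
  have a2 := fun i => stepD_i β hβ hn μ hμinv hN b hb C3 hC3.le (h3 n hn) CV hCV.le hV h i
  rw [← hC2] at a2
  generalize (∫ p, g' (wS n β b (totalSpin p.2)) ∂(JM β μ n)) = Y at *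
  generalize (∫ p, wS n β b (totalSpin p.2) * g (wS n β b (totalSpin p.2)) ∂(JM β μ n)) = X at *
  set L : Fin n → ℝ := fun i => ∫ p, ai p.1 (p.2 i) * g (wS n β b (totalSpin p.2)) ∂(JM β μ n)
  have a3 : |∑ i, L i - 2 * β * √n * Vf N b * Y| ≤ C2 := by
    have e : ∑ i, L i - 2 * β * √n * Vf N b * Y = ∑ i, (L i - 2 * β / √n * Vf N b * Y) := by
      rw [Finset.sum_sub_distrib]
      simp only [Finset.sum_const, Finset.card_univ, Fintype.card_fin, nsmul_eq_mul]
      congr 1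
      nth_rewrite 2 [← hsq]
      field_simp
    rw [e]
    calc _ ≤ ∑ i, |L i - 2 * β / √n * Vf N b * Y| := Finset.abs_sum_le_sum_abs _ _
      _ ≤ ∑ _i : Fin n, C2 / n := Finset.sum_le_sum fun i _ => a2 i
      _ = C2 := by simp; field_simp
  rw [le_div_iff₀ hs, ← abs_of_pos hs, ← abs_mul]
  have e : (α * b^2 * X - 2 * β * Vf N b * Y) * √n = (∑ i, L i - 2 * β * √n * Vf N b * Y) - (∑ i, L i - √n * α * b^2 * X) := by ring
  rw [e]
  calc _ ≤ _ := abs_sub _ _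
    _ ≤ C2 + C1 := add_le_add a3 a1
    _ ≤ _ := by rw [add_comm]; exact le_abs_self _

end PartI
noncomputable section

/-- Wasserstein bound of the main theorem: for `β > N`,
`sup_{‖h'‖ ≤ 1} |E h(W_n/B) - E h(Z)| ≤ C n^{-1/2}`. -/
theorem wasserstein_bound (N : ℕ) (hN : 2 ≤ N)
    (μ : Measure (UnitSphere N)) [IsProbabilityMeasure μ]
    (hμinv : ∀ e : EuclideanSpace ℝ (Fin N) ≃ₗᵢ[ℝ] EuclideanSpace ℝ (Fin N),
      Measure.map (sphereMap e) μ = μ)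
    (β : ℝ) (hβ : (N : ℝ) < β)
    (b : ℝ) (hb : 0 < b) (hbfix : b = β * besselRatio N b)
    (B : ℝ) (hB : 0 < B)
    (hBsq : B ^ 2 = 4 * β ^ 2 / ((1 - β * deriv (besselRatio N) b) * b ^ 2) *
      (1 - ((N : ℝ) - 1) * besselRatio N b / b - besselRatio N b ^ 2)) :
    ∃ C > 0, ∀ n : ℕ, 1 ≤ n → ∀ h : ℝ → ℝ, Differentiable ℝ h →
      (∀ x, |deriv h x| ≤ 1) →
      |(∫ σ, h (Wspin N n β b σ / B) ∂(gibbsMeasure N n β μ)) -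
          ∫ x, h x ∂(ProbabilityTheory.gaussianReal 0 1)| ≤ C / Real.sqrt n := by
  have hN2 : (2:ℝ) ≤ N := by exact_mod_cast hN
  have hβ0 : 0 < β := by linarith
  have hKb : Kf N b = 1 / β := by
    rw [besselRatio_eq] at hbfix
    have : b * (β * Kf N b) = b * 1 := by linarith
    have := mul_left_cancel₀ hb.ne' this
    field_simp
    linarith
  have hKd := Kd_neg N hN b hb
  set α := -Kd N b * b / 2 with hα
  have hα0 : 0 < α := by
    have : 0 < -Kd N b * b := mul_pos (by linarith) hb
    linarith
  have hB2 : α * b^2 * B^2 = 2 * β * Vf N b := by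
    rw [besselRatio_deriv N hN b hb, besselRatio_eq, hKb] at hBsq
    have e1 : 1 - β * (1 / β + b * Kd N b) = 2 * β * α := by
      rw [hα]; field_simp; ring
    rw [e1] at hBsq
    rw [hBsq, Vf, hKb]
    field_simp
    ring
  obtain ⟨c, hc, hst⟩ := stein_sol
  set c' := c * (1 + 1 / B + 1 / B^2) with hc'
  obtain ⟨C, hC, hbd⟩ := stein_bound β hβ0 μ hμinv hN b hb hKb c'
  refine ⟨C / (α * b^2 * B) + 1, by positivity, fun n hn h hd hl => ?_⟩
  have hn0 : (0:ℝ) < n := by exact_mod_cast hn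
  have hs : 0 < √(n:ℝ) := by positivity
  obtain ⟨g, g', gd, geq, gb, gb', gl⟩ := hst h hd hl
  have hGG : GG c' (fun w => g (w / B)) (fun w => g' (w / B) / B) := by
    have i1 : 0 < 1 / B := by positivity
    have i2 : 0 < 1 / B^2 := by positivity
    refine ⟨fun x => ?_, fun x => ?_, fun x => ?_, fun x y => ?_⟩
    · have := (gd (x / B)).comp x ((hasDerivAt_id x).div_const B)
      simpa [div_eq_mul_inv, Function.comp_def] using this
    · refine (gb _).trans ?_
      rw [hc']; nlinarith [mul_pos hc i1, mul_pos hc i2]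
    · rw [abs_div, abs_of_pos hB, div_eq_mul_one_div]
      have := mul_le_mul_of_nonneg_right (gb' (x / B)) i1.le
      rw [hc']; nlinarith [mul_pos hc i1, mul_pos hc i2]
    · have e : g' (x / B) / B - g' (y / B) / B = (g' (x / B) - g' (y / B)) * (1 / B) := by ring
      have e2 : |x / B - y / B| = |x - y| * (1 / B) := by
        rw [← sub_div, abs_div, abs_of_pos hB]; ring
      have := mul_le_mul_of_nonneg_right (gl (x / B) (y / B)) i1.le
      rw [e, abs_mul, abs_of_pos i1]
      refine this.trans ?_
      rw [e2]
      have e3 : c * (|x - y| * (1 / B)) * (1 / B) = c * (1 / B^2) * |x - y| := by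
        field_simp
      rw [e3]
      refine mul_le_mul_of_nonneg_right ?_ (abs_nonneg _)
      rw [hc']; nlinarith [mul_pos hc i1, mul_pos hc i2]
  have key := hbd n hn _ _ hGG
  have hφ : Continuous fun σ : Om N n => h (Wspin N n β b σ / B) :=
    hd.continuous.comp (((wS_cont β b).comp totalSpin_cont).div_const B)
  rw [← JM_snd β hβ0 hn μ hφ]
  set m := ∫ x, h x ∂(ProbabilityTheory.gaussianReal 0 1) with hm
  have pg := PG.gW (N := N) (n := n) β hGG.cont b
  have pg' := PG.gW (N := N) (n := n) β hGG.cont' b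
  have pw := PG.gW (N := N) (n := n) β continuous_id b
  simp only [id] at pw
  have e0 : ∀ p : EE N × Om N n, h (Wspin N n β b p.2 / B) - m =
      B * (g' (wS n β b (totalSpin p.2) / B) / B) -
        1 / B * (wS n β b (totalSpin p.2) * g (wS n β b (totalSpin p.2) / B)) := fun p => by
    rw [← geq, Wspin_eq]
    field_simp
  have e1 := JM_sub β hβ0 hn μ (PG.snd hφ) (PG.const m)
  rw [JM_const β hβ0 hn μ] at e1
  rw [← e1]
  simp_rw [e0]
  rw [JM_sub β hβ0 hn μ ((PG.const B).mul pg') ((PG.const (1 / B)).mul (pw.mul pg)), integral_const_mul, integral_const_mul]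
  generalize (∫ p, g' (wS n β b (totalSpin p.2) / B) / B ∂(JM β μ n)) = Y at *
  generalize (∫ p, wS n β b (totalSpin p.2) * g (wS n β b (totalSpin p.2) / B) ∂(JM β μ n)) = X at *
  rw [← hB2] at key
  have e2 : B * Y - 1 / B * X = -(1 / (α * b^2 * B) * (α * b^2 * X - α * b^2 * B^2 * Y)) := by
    field_simp
    ring
  have hp : 0 < 1 / (α * b^2 * B) := by positivity
  rw [e2, abs_neg, abs_mul, abs_of_pos hp]
  calc _ ≤ 1 / (α * b^2 * B) * (C / √n) := mul_le_mul_of_nonneg_left key hp.le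
    _ = C / (α * b^2 * B) / √n := by ring
    _ ≤ _ := by gcongr; linarith

end
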